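/- arXiv:math/0411257 — 10 statements merged into one kernel-verified Lean document; each statement's English description precedes it below -/
import Mathlib

section
/- Let μ ≠ 0 be a nilpotent Lie bracket on ℝ^{2n} for which ω is closed and such that Ricac_μ = cI + D for some c ∈ ℝ and D ∈ Der(μ). If g ∈ Sp(n,ℝ) is such that Ricac_{g·μ} = c′I + D′ for some c′ ∈ ℝ and D′ ∈ Der(g·μ), then there exist r ∈ ℝ, r ≠ 0, and k ∈ Sp(n,ℝ) ∩ O(2n) such that g·μ = r (k·μ). -/
open scoped BigOperators Matrix

abbrev Vm (m : ℕ) := (Fin m → ℝ) → (Fin m → ℝ) → (Fin m → ℝ)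

def IsSkewBilin {m : ℕ} (μ : Vm m) : Prop :=
  (∀ (c : ℝ) (X X' Y : Fin m → ℝ), μ (c • X + X') Y = c • μ X Y + μ X' Y) ∧
  (∀ (c : ℝ) (X Y Y' : Fin m → ℝ), μ X (c • Y + Y') = c • μ X Y + μ X Y') ∧
  (∀ X Y, μ X Y = - μ Y X)

/-- The Jacobi identity. -/
def Jacobi {m : ℕ} (μ : Vm m) : Prop :=
  ∀ X Y Z, μ (μ X Y) Z + μ (μ Y Z) X + μ (μ Z X) Y = 0

/-- Left-normed iterated bracket `μ(X_k, μ(X_{k-1}, ⋯ μ(X_1, X_0)⋯))`. -/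
def iterBrk {m : ℕ} (μ : Vm m) (X : ℕ → (Fin m → ℝ)) : ℕ → (Fin m → ℝ)
  | 0 => X 0
  | (k+1) => μ (X (k+1)) (iterBrk μ X k)

/-- `(ℝᵐ, μ)` is a nilpotent Lie algebra: some term of the lower central series vanishes,
equivalently all left-normed brackets of some fixed length vanish. -/
def IsNilp {m : ℕ} (μ : Vm m) : Prop :=
  ∃ k : ℕ, ∀ X : ℕ → (Fin m → ℝ), iterBrk μ X k = 0

noncomputable def stdb (m : ℕ) (i : Fin m) : Fin m → ℝ := Pi.single i 1

noncomputable def Ric {m : ℕ} (μ : Vm m) : Matrix (Fin m) (Fin m) ℝ :=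
  Matrix.of fun x y =>
    -(1/2) * (∑ i, ∑ j, μ (stdb m x) (stdb m i) j * μ (stdb m y) (stdb m i) j)
      + (1/4) * (∑ i, ∑ j, μ (stdb m i) (stdb m j) x * μ (stdb m i) (stdb m j) y)

noncomputable def normSq {m : ℕ} (μ : Vm m) : ℝ :=
  ∑ i, ∑ j, ∑ k, (μ (stdb m i) (stdb m j) k) ^ 2

/-- `D` is a derivation of the bracket `μ`. -/
def IsDeriv {m : ℕ} (μ : Vm m) (D : Matrix (Fin m) (Fin m) ℝ) : Prop :=
  ∀ X Y, D.mulVec (μ X Y) = μ (D.mulVec X) Y + μ X (D.mulVec Y)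

/-- The action `(g·μ)(X,Y) = g μ(g⁻¹X, g⁻¹Y)` of `GL(n,ℝ)` on brackets. -/
noncomputable def act {m : ℕ} (g : GL (Fin m) ℝ) (μ : Vm m) : Vm m :=
  fun X Y =>
    (g : Matrix (Fin m) (Fin m) ℝ).mulVec
      (μ (((g⁻¹ : GL (Fin m) ℝ) : Matrix (Fin m) (Fin m) ℝ).mulVec X)
         (((g⁻¹ : GL (Fin m) ℝ) : Matrix (Fin m) (Fin m) ℝ).mulVec Y))


/-- The standard (almost-)complex structure `J` on `ℝ^{2n}`:
`J e_i = e_{2n+1-i}` for `i ≤ n` and `J e_i = -e_{2n+1-i}` for `i > n` (1-indexed). -/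
noncomputable def Jst (n : ℕ) : Matrix (Fin (2*n)) (Fin (2*n)) ℝ :=
  Matrix.of fun x y =>
    if (x : ℕ) + (y : ℕ) = 2*n - 1 then (if (y : ℕ) < n then 1 else -1) else 0

/-- The symplectic form `ω(X,Y) = ⟨X, JY⟩` on `ℝ^{2n}`. -/
noncomputable def omegaSt (n : ℕ) (X Y : Fin (2*n) → ℝ) : ℝ :=
  ∑ i, X i * (Jst n).mulVec Y i

/-- `ω` is closed for the bracket `μ`. -/
def OmegaClosed (n : ℕ) (μ : Vm (2*n)) : Prop :=
  ∀ X Y Z, omegaSt n (μ X Y) Z + omegaSt n (μ Y Z) X + omegaSt n (μ Z X) Y = 0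

/-- Membership in `Sp(n,ℝ)`: `g` preserves `ω`. -/
def InSp (n : ℕ) (g : GL (Fin (2*n)) ℝ) : Prop :=
  ∀ X Y, omegaSt n ((g : Matrix (Fin (2*n)) (Fin (2*n)) ℝ).mulVec X)
      ((g : Matrix (Fin (2*n)) (Fin (2*n)) ℝ).mulVec Y) = omegaSt n X Y

/-- The anti-complexified Ricci operator `Ricac_μ = (1/2)(Ric_μ + J Ric_μ J)`. -/
noncomputable def Ricac (n : ℕ) (μ : Vm (2*n)) : Matrix (Fin (2*n)) (Fin (2*n)) ℝ :=
  (1/2 : ℝ) • (Ric μ + Jst n * Ric μ * Jst n)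

open NormedSpace (exp)

section MatrixExp

variable {m : ℕ}

theorem exists_orthogonal_diagonal {A : Matrix (Fin m) (Fin m) ℝ} (hA : Aᵀ = A) :
    ∃ (U : Matrix (Fin m) (Fin m) ℝ) (a : Fin m → ℝ), Uᵀ * U = 1 ∧ U * Uᵀ = 1 ∧
      A = U * Matrix.diagonal a * Uᵀ := by
  have hH : A.IsHermitian := by
    rwa [Matrix.IsHermitian, Matrix.conjTranspose_eq_transpose_of_trivial]
  refine ⟨hH.eigenvectorUnitary, hH.eigenvalues, ?_, ?_, ?_⟩
  · simpa [Matrix.star_eq_conjTranspose, Matrix.conjTranspose_eq_transpose_of_trivial] using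
      Unitary.coe_star_mul_self hH.eigenvectorUnitary
  · simpa [Matrix.star_eq_conjTranspose, Matrix.conjTranspose_eq_transpose_of_trivial] using
      Unitary.coe_mul_star_self hH.eigenvectorUnitary
  · conv_lhs => rw [hH.spectral_theorem]
    simp [Unitary.conjStarAlgAut_apply, Matrix.star_eq_conjTranspose,
      Matrix.conjTranspose_eq_transpose_of_trivial]

theorem exp_orthogonal_conj {U : Matrix (Fin m) (Fin m) ℝ} (h : U * Uᵀ = 1)
    (A : Matrix (Fin m) (Fin m) ℝ) : exp (U * A * Uᵀ) = U * exp A * Uᵀ := by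
  have hi : U⁻¹ = Uᵀ := Matrix.inv_eq_right_inv h
  rw [← hi]
  exact Matrix.exp_conj U A ((Matrix.isUnit_iff_isUnit_det _).2
    (Matrix.isUnit_det_of_right_inverse h))

theorem exp_orthogonal_conj_diagonal {U : Matrix (Fin m) (Fin m) ℝ} (h : U * Uᵀ = 1)
    (a : Fin m → ℝ) : exp (U * Matrix.diagonal a * Uᵀ) =
      U * Matrix.diagonal (fun i => Real.exp (a i)) * Uᵀ := by
  rw [exp_orthogonal_conj h, Matrix.exp_diagonal]
  congr 3
  ext i
  rw [Pi.coe_exp, Real.exp_eq_exp_ℝ]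

theorem exp_mul_exp_neg (A : Matrix (Fin m) (Fin m) ℝ) : exp A * exp (-A) = 1 := by
  rw [← Matrix.exp_add_of_commute _ _ (Commute.refl A).neg_right, add_neg_cancel,
    NormedSpace.exp_zero]

theorem exp_neg_mul_exp (A : Matrix (Fin m) (Fin m) ℝ) : exp (-A) * exp A = 1 := by
  simpa using exp_mul_exp_neg (-A)

theorem exp_mul_self (A : Matrix (Fin m) (Fin m) ℝ) : exp A * exp A = exp ((2 : ℝ) • A) := by
  rw [two_smul, Matrix.exp_add_of_commute _ _ (Commute.refl A)]

theorem exp_mul_of_anticommute {A J : Matrix (Fin m) (Fin m) ℝ} (hJ : J * J = -1)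
    (h : A * J = -(J * A)) : exp A * J = J * exp (-A) := by
  have hJi : J⁻¹ = -J := Matrix.inv_eq_right_inv (by simp [hJ])
  have hu : IsUnit J := ⟨⟨J, -J, by simp [hJ], by simp [hJ]⟩, rfl⟩
  have h1 := Matrix.exp_conj' J A hu
  have h2 : J⁻¹ * A * J = -A := by
    rw [mul_assoc, h, hJi]; simp [← mul_assoc, hJ]
  rw [h2, hJi] at h1
  rw [h1]; simp [← mul_assoc, hJ]

theorem trace_orthogonal_diagonal_mul (U V : Matrix (Fin m) (Fin m) ℝ) (f g : Fin m → ℝ) :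
    Matrix.trace ((U * Matrix.diagonal f * Uᵀ) * (V * Matrix.diagonal g * Vᵀ)) =
      ∑ i, ∑ j, (Uᵀ * V) i j ^ 2 * (f i * g j) := by
  have h1 : Matrix.trace ((U * Matrix.diagonal f * Uᵀ) * (V * Matrix.diagonal g * Vᵀ)) =
      Matrix.trace ((Matrix.diagonal f * (Uᵀ * V) * Matrix.diagonal g) * (Uᵀ * V)ᵀ) := by
    rw [Matrix.transpose_mul, Matrix.transpose_transpose]
    simp only [mul_assoc]
    rw [Matrix.trace_mul_comm U]
    simp only [mul_assoc]
  rw [h1]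
  simp only [Matrix.trace, Matrix.diag]
  refine Finset.sum_congr rfl fun i _ => ?_
  rw [Matrix.mul_apply]
  simp only [Matrix.transpose_apply (Uᵀ * V), Matrix.mul_diagonal, Matrix.diagonal_mul]
  exact Finset.sum_congr rfl fun j _ => by ring

theorem exp_injOn_symm {A B : Matrix (Fin m) (Fin m) ℝ} (hA : Aᵀ = A) (hB : Bᵀ = B)
    (h : exp A = exp B) : A = B := by
  obtain ⟨U, a, hU, hU', rfl⟩ := exists_orthogonal_diagonal hA
  obtain ⟨V, b, hV, hV', rfl⟩ := exists_orthogonal_diagonal hB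
  rw [exp_orthogonal_conj_diagonal hU', exp_orthogonal_conj_diagonal hV'] at h
  have key : ∀ x y : Fin m → ℝ,
      U * Matrix.diagonal x * Uᵀ = V * Matrix.diagonal y * Vᵀ ↔
        Matrix.diagonal x * (Uᵀ * V) = (Uᵀ * V) * Matrix.diagonal y := by
    intro x y
    constructor
    · intro h
      calc _ = Uᵀ * U * Matrix.diagonal x * Uᵀ * V := by rw [hU]; simp [mul_assoc]
        _ = Uᵀ * (U * Matrix.diagonal x * Uᵀ) * V := by simp only [mul_assoc]
        _ = Uᵀ * V * Matrix.diagonal y * (Vᵀ * V) := by rw [h]; simp only [mul_assoc]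
        _ = _ := by rw [hV, mul_one]
    · intro h
      calc _ = U * (Matrix.diagonal x * (Uᵀ * V)) * Vᵀ := by
            simp only [mul_assoc]; rw [hV', mul_one]
        _ = (U * Uᵀ) * V * Matrix.diagonal y * Vᵀ := by rw [h]; simp only [mul_assoc]
        _ = _ := by rw [hU', one_mul]
  rw [key] at h ⊢
  ext i j
  have hij := congrFun (congrFun h i) j
  rw [Matrix.diagonal_mul, Matrix.mul_diagonal] at hij ⊢
  by_cases h0 : (Uᵀ * V) i j = 0
  · simp [h0]
  · have : a i = b j := Real.exp_injective (mul_right_cancel₀ h0 (by linarith))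
    rw [this]; ring

/-- Any matrix of the form `gᵀ * g` with `g` symplectic is the exponential of a symmetric
matrix that anticommutes with the complex structure. -/
theorem exists_log_gram {J g : Matrix (Fin m) (Fin m) ℝ} (hJ : J * J = -1) (hJt : Jᵀ = -J)
    (hg : gᵀ * J * g = J) :
    ∃ A : Matrix (Fin m) (Fin m) ℝ, Aᵀ = A ∧ A * J = -(J * A) ∧ exp A * exp A = gᵀ * g := by
  have hinv : (-(J * gᵀ * J)) * g = 1 := by
    rw [neg_mul, mul_assoc, mul_assoc, ← mul_assoc gᵀ, hg, hJ, neg_neg]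
  have hinv' : g * (-(J * gᵀ * J)) = 1 := mul_eq_one_comm.1 hinv
  have hg' : g * J * gᵀ = J := by
    have h2 : g * J * gᵀ * J = -1 := by
      rw [← hinv', mul_neg, neg_neg]; simp only [mul_assoc]
    calc g * J * gᵀ = -(g * J * gᵀ * J * J) := by rw [mul_assoc _ J J, hJ]; simp
      _ = J := by rw [h2]; simp
  have hpd : (gᵀ * g).PosDef := by
    have := Matrix.PosDef.conjTranspose_mul_self g (Matrix.mulVec_injective_of_isUnit
      ⟨⟨g, -(J * gᵀ * J), hinv', hinv⟩, rfl⟩)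
    rwa [Matrix.conjTranspose_eq_transpose_of_trivial] at this
  obtain ⟨U, l, hU, hU', hP⟩ := exists_orthogonal_diagonal (A := gᵀ * g) (by simp)
  have hl : ∀ i, 0 < l i := by
    have h1 : (Uᵀ * (gᵀ * g) * U).PosDef := by
      have := hpd.conjTranspose_mul_mul_same (B := U) (Matrix.mulVec_injective_of_isUnit
        ⟨⟨U, Uᵀ, hU', hU⟩, rfl⟩)
      rwa [Matrix.conjTranspose_eq_transpose_of_trivial] at this
    have h2 : Uᵀ * (gᵀ * g) * U = Matrix.diagonal l := by
      rw [hP]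
      calc _ = (Uᵀ * U) * Matrix.diagonal l * (Uᵀ * U) := by simp only [mul_assoc]
        _ = _ := by rw [hU]; simp
    rw [h2, Matrix.posDef_diagonal_iff] at h1
    exact h1
  set A := U * Matrix.diagonal (fun i => Real.log (l i) / 2) * Uᵀ with hAdef
  have hAt : Aᵀ = A := by simp [hAdef, mul_assoc]
  have hA2 : exp A * exp A = gᵀ * g := by
    rw [hAdef, exp_orthogonal_conj_diagonal hU', hP]
    calc _ = U * Matrix.diagonal (fun i => Real.exp (Real.log (l i) / 2)) * (Uᵀ * U) *
          Matrix.diagonal (fun i => Real.exp (Real.log (l i) / 2)) * Uᵀ := by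
            simp only [mul_assoc]
      _ = U * Matrix.diagonal (fun i => Real.exp (Real.log (l i) / 2) *
          Real.exp (Real.log (l i) / 2)) * Uᵀ := by
            rw [hU, mul_one, mul_assoc U, Matrix.diagonal_mul_diagonal]
      _ = _ := by
            congr 3; ext i; rw [← Real.exp_add, add_halves, Real.exp_log (hl i)]
  refine ⟨A, hAt, ?_, hA2⟩
  have hJA : J * A * (-J) = -A := by
    have hu : IsUnit J := ⟨⟨J, -J, by simp [hJ], by simp [hJ]⟩, rfl⟩
    have hJi : J⁻¹ = -J := Matrix.inv_eq_right_inv (by simp [hJ])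
    have h2 : (2 : ℝ) • (J * A * (-J)) = (2 : ℝ) • (-A) := by
      apply exp_injOn_symm
      · simp [hAt, hJt, mul_assoc]
      · simp [hAt]
      · have e1 : (2 : ℝ) • (J * A * (-J)) = J * ((2 : ℝ) • A) * J⁻¹ := by rw [hJi]; simp
        rw [e1, Matrix.exp_conj J _ hu, ← exp_mul_self, hA2, smul_neg, hJi]
        have e2 : gᵀ * g * J * (gᵀ * g) = J := by
          rw [← mul_assoc, mul_assoc gᵀ, mul_assoc gᵀ, hg', hg]
        have e3 := exp_mul_exp_neg ((2 : ℝ) • A)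
        rw [← exp_mul_self, hA2] at e3
        have e4 : J * (gᵀ * g) * (-J) * (gᵀ * g) = 1 := by
          have : J * (gᵀ * g) * (-J) * (gᵀ * g) = -(J * (gᵀ * g * J * (gᵀ * g))) := by
            simp [mul_assoc]
          rw [this, e2, hJ, neg_neg]
        calc J * (gᵀ * g) * (-J) = J * (gᵀ * g) * (-J) * (gᵀ * g * exp (-((2 : ℝ) • A))) := by
              rw [e3, mul_one]
          _ = _ := by rw [← mul_assoc, e4, one_mul]
    exact smul_right_injective _ (two_ne_zero) h2
  calc A * J = -(-A * J) := by simp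
    _ = _ := by rw [← hJA, mul_assoc]; simp [hJ]

theorem sq_le_of_exp (a b N : ℝ) (hN : |a| ≤ N) :
    b * b ≤ a * a + 2 * (a * Real.exp (-a) * Real.exp b - a) +
      (2 * N + 1) * (Real.exp (-a) * Real.exp b + Real.exp a * Real.exp (-b) - 2) := by
  obtain ⟨d, rfl⟩ : ∃ d, b = a + d := ⟨b - a, by ring⟩
  have e1 : Real.exp (-a) * Real.exp (a + d) = Real.exp d := by
    rw [← Real.exp_add]; ring_nf
  have e2 : Real.exp a * Real.exp (-(a + d)) = Real.exp (-d) := by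
    rw [← Real.exp_add]; ring_nf
  rw [mul_assoc a, e1, e2]
  have h1 := Real.add_one_le_exp d
  have h2 := Real.add_one_le_exp (-d)
  have h3 : d ^ 2 ≤ Real.exp d + Real.exp (-d) - 2 := by
    have h5 : (d / 2) ^ 2 ≤ Real.sinh (d / 2) ^ 2 := by
      rcases le_total 0 (d / 2) with h | h
      · have := Real.self_le_sinh_iff.2 h
        nlinarith
      · have := Real.sinh_le_self_iff.2 h
        nlinarith
    have h6 := Real.cosh_two_mul (d / 2)
    have h7 := Real.cosh_sq (d / 2)
    rw [mul_div_cancel₀ d two_ne_zero, Real.cosh_eq] at h6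
    linarith
  have h4 : -(a * (Real.exp d - 1 - d)) ≤ N * (Real.exp d + Real.exp (-d) - 2) := by
    have h5 : -a ≤ N := (neg_le_abs a).trans hN
    have h6 : 0 ≤ N := (abs_nonneg a).trans hN
    nlinarith [mul_le_mul_of_nonneg_right h5 (by linarith : 0 ≤ Real.exp d - 1 - d),
      mul_nonneg h6 (by linarith : 0 ≤ Real.exp (-d) - 1 + d)]
  nlinarith

end MatrixExp

section Variation

variable {m : ℕ}

theorem trace_sq_le_of_exp {L : Matrix (Fin m) (Fin m) ℝ} (hL : Lᵀ = L) :
    ∃ N : ℝ, ∀ L' : Matrix (Fin m) (Fin m) ℝ, L'ᵀ = L' →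
      Matrix.trace (L' * L') ≤ Matrix.trace (L * L) +
        2 * (Matrix.trace (L * exp (-L) * exp L') - Matrix.trace (L * exp (-L) * exp L)) +
        N * ((Matrix.trace (exp (-L) * exp L') + Matrix.trace (exp L * exp (-L'))) -
          (Matrix.trace (exp (-L) * exp L) + Matrix.trace (exp L * exp (-L)))) := by
  obtain ⟨U, a, hU, hU', hLU⟩ := exists_orthogonal_diagonal hL
  obtain ⟨N, hN⟩ : ∃ N, ∀ i, |a i| ≤ N := ⟨∑ i, |a i|, fun i =>
    Finset.single_le_sum (f := fun i => |a i|) (fun i _ => abs_nonneg _) (Finset.mem_univ i)⟩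
  refine ⟨2 * N + 1, fun L' hL' => ?_⟩
  obtain ⟨V, b, hV, hV', hLV⟩ := exists_orthogonal_diagonal hL'
  have conj_mul : ∀ {W : Matrix (Fin m) (Fin m) ℝ} (_ : Wᵀ * W = 1) (x y : Fin m → ℝ),
      (W * Matrix.diagonal x * Wᵀ) * (W * Matrix.diagonal y * Wᵀ) =
        W * Matrix.diagonal (fun i => x i * y i) * Wᵀ := by
    intro W hW x y
    calc _ = W * Matrix.diagonal x * (Wᵀ * W) * Matrix.diagonal y * Wᵀ := by
          simp only [mul_assoc]
      _ = _ := by rw [hW, mul_one, mul_assoc W, Matrix.diagonal_mul_diagonal]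
  have conj_neg : ∀ (W : Matrix (Fin m) (Fin m) ℝ) (x : Fin m → ℝ),
      -(W * Matrix.diagonal x * Wᵀ) = W * Matrix.diagonal (fun i => -x i) * Wᵀ := by
    intro W x
    have : Matrix.diagonal (fun i => -x i) = -Matrix.diagonal x :=
      (Matrix.diagonal_neg x).symm
    rw [this, mul_neg, neg_mul]
  have conj_one : ∀ {W : Matrix (Fin m) (Fin m) ℝ} (_ : W * Wᵀ = 1),
      (1 : Matrix (Fin m) (Fin m) ℝ) = W * Matrix.diagonal (fun _ => 1) * Wᵀ := by
    intro W hW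
    rw [Matrix.diagonal_one, mul_one, hW]
  have t1 := trace_orthogonal_diagonal_mul U V (fun _ => 1) (fun j => b j * b j)
  have t2 := trace_orthogonal_diagonal_mul U V (fun i => a i * a i) (fun _ => 1)
  have t3 := trace_orthogonal_diagonal_mul U V (fun i => a i * Real.exp (-a i))
    (fun j => Real.exp (b j))
  have t4 := trace_orthogonal_diagonal_mul U V a (fun _ => 1)
  have t5 := trace_orthogonal_diagonal_mul U V (fun i => Real.exp (-a i)) (fun j => Real.exp (b j))
  have t6 := trace_orthogonal_diagonal_mul U V (fun i => Real.exp (a i)) (fun j => Real.exp (-b j))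
  have t7 := trace_orthogonal_diagonal_mul U V (fun _ => 1) (fun _ => 1)
  rw [← conj_mul hV, ← hLV, ← conj_one hU', one_mul] at t1
  rw [← conj_mul hU, ← hLU, ← conj_one hV', mul_one] at t2
  rw [← conj_mul hU, ← exp_orthogonal_conj_diagonal hU', ← conj_neg, ← hLU,
    ← exp_orthogonal_conj_diagonal hV', ← hLV] at t3
  rw [← hLU, ← conj_one hV', mul_one] at t4
  rw [← exp_orthogonal_conj_diagonal hU', ← conj_neg, ← hLU,
    ← exp_orthogonal_conj_diagonal hV', ← hLV] at t5
  rw [← exp_orthogonal_conj_diagonal hU', ← hLU,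
    ← exp_orthogonal_conj_diagonal hV', ← conj_neg, ← hLV] at t6
  rw [← conj_one hU', ← conj_one hV', one_mul] at t7
  rw [mul_assoc L _ (exp L), exp_neg_mul_exp, exp_mul_exp_neg, mul_one, t1, t2, t3, t4, t5, t6, t7]
  simp only [← Finset.sum_add_distrib, ← Finset.sum_sub_distrib, Finset.mul_sum]
  refine Finset.sum_le_sum fun i _ => Finset.sum_le_sum fun j _ => ?_
  have := sq_le_of_exp (a i) (b j) N (hN i)
  have := mul_le_mul_of_nonneg_left this (sq_nonneg ((Uᵀ * V) i j))
  linarith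

open scoped Matrix.Norms.Operator

theorem hasDerivAt_trace_const_mul (C : Matrix (Fin m) (Fin m) ℝ)
    {Q : ℝ → Matrix (Fin m) (Fin m) ℝ} {Q' : Matrix (Fin m) (Fin m) ℝ} {t : ℝ}
    (hQ : HasDerivAt Q Q' t) :
    HasDerivAt (fun s => Matrix.trace (C * Q s)) (Matrix.trace (C * Q')) t :=
  ((Matrix.traceLinearMap (Fin m) ℝ ℝ).toContinuousLinearMap.hasFDerivAt.comp_hasDerivAt t
    (hQ.const_mul C))

/-- First variation of `tr (L * L)` along a curve `exp L(t)` of positive definite matrices. -/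
theorem trace_mul_deriv_eq_zero_of_min {L : Matrix (Fin m) (Fin m) ℝ} (hL : Lᵀ = L)
    {Q R : ℝ → Matrix (Fin m) (Fin m) ℝ} {Q' R' : Matrix (Fin m) (Fin m) ℝ}
    (hQ : HasDerivAt Q Q' 0) (hR : HasDerivAt R R' 0) (hQR : ∀ t, Q t * R t = 1)
    (hQ0 : Q 0 = exp L)
    (hmin : ∀ t, ∃ L' : Matrix (Fin m) (Fin m) ℝ, L'ᵀ = L' ∧ exp L' = Q t ∧
      Matrix.trace (L * L) ≤ Matrix.trace (L' * L')) :
    Matrix.trace (L * exp (-L) * Q') = 0 := by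
  obtain ⟨N, hN⟩ := trace_sq_le_of_exp hL
  have hR0 : R 0 = exp (-L) := by
    have := hQR 0
    rw [hQ0] at this
    calc R 0 = exp (-L) * exp L * R 0 := by rw [exp_neg_mul_exp, one_mul]
      _ = _ := by rw [mul_assoc, this, mul_one]
  set ψ : ℝ → ℝ := fun t => 2 * Matrix.trace (L * exp (-L) * Q t) +
    N * (Matrix.trace (exp (-L) * Q t) + Matrix.trace (exp L * R t)) with hψ
  have hψmin : IsLocalMin ψ 0 := by
    refine Filter.Eventually.of_forall fun t => ?_
    obtain ⟨L', hL', hQt, hle⟩ := hmin t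
    have hRt : R t = exp (-L') := by
      have := hQR t
      rw [← hQt] at this
      calc R t = exp (-L') * exp L' * R t := by rw [exp_neg_mul_exp, one_mul]
        _ = _ := by rw [mul_assoc, this, mul_one]
    have := hN L' hL'
    simp only [hψ, hQ0, hR0, ← hQt, hRt]
    linarith
  have hd := hψmin.hasDerivAt_eq_zero
    (((hasDerivAt_trace_const_mul (L * exp (-L)) hQ).const_mul 2).add
      (((hasDerivAt_trace_const_mul (exp (-L)) hQ).add
        (hasDerivAt_trace_const_mul (exp L) hR)).const_mul N))
  have hprod : Q' * R 0 + Q 0 * R' = 0 := by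
    have h1 := hQ.mul hR
    have h2 : Q * R = fun _ => 1 := funext hQR
    rw [h2] at h1
    exact h1.unique (hasDerivAt_const _ _)
  have htr := congrArg Matrix.trace hprod
  rw [hR0, hQ0, Matrix.trace_add, Matrix.trace_zero, Matrix.trace_mul_comm Q'] at htr
  rw [htr] at hd
  linarith

theorem hasDerivAt_exp_smul_zero (B : Matrix (Fin m) (Fin m) ℝ) :
    HasDerivAt (fun t : ℝ => exp (t • B)) B 0 := by
  have := hasDerivAt_exp_smul_const (𝕂 := ℝ) B (0 : ℝ)
  rw [zero_smul, NormedSpace.exp_zero, one_mul] at this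
  exact this

theorem trace_mul_eq_zero_of_min_right {A B : Matrix (Fin m) (Fin m) ℝ} (hA : Aᵀ = A)
    (hmin : ∀ t : ℝ, ∃ A' : Matrix (Fin m) (Fin m) ℝ, A'ᵀ = A' ∧
      exp A' * exp A' = exp (t • B) * (exp A * exp A) * exp (t • B) ∧
      Matrix.trace (A * A) ≤ Matrix.trace (A' * A')) :
    Matrix.trace (A * B) = 0 := by
  have hd := hasDerivAt_exp_smul_zero B
  have hd' := hasDerivAt_exp_smul_zero (-B)
  have key := trace_mul_deriv_eq_zero_of_min (L := (2 : ℝ) • A)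
    (Q := fun t => exp (t • B) * exp ((2 : ℝ) • A) * exp (t • B))
    (R := fun t => exp (t • -B) * exp (-((2 : ℝ) • A)) * exp (t • -B))
    (by simp [hA]) ((hd.mul_const _).mul hd) ((hd'.mul_const _).mul hd') ?_ (by simp) ?_
  · simp only [zero_smul, NormedSpace.exp_zero, mul_one, one_mul] at key
    rw [mul_add, Matrix.trace_add, mul_assoc _ _ (exp _ * B), ← mul_assoc _ _ B,
      exp_neg_mul_exp, one_mul, ← mul_assoc, Matrix.trace_mul_comm _ (exp _)] at key
    have e : exp ((2 : ℝ) • A) * ((2 : ℝ) • A * exp (-((2 : ℝ) • A)) * B) = (2 : ℝ) • A * B := by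
      have hc : Commute (exp ((2 : ℝ) • A)) ((2 : ℝ) • A) := (Commute.refl _).exp_left
      rw [← mul_assoc, ← mul_assoc, hc.eq, mul_assoc ((2 : ℝ) • A), exp_mul_exp_neg, mul_one]
    rw [e, smul_mul_assoc, Matrix.trace_smul] at key
    simp only [smul_eq_mul] at key
    linarith
  · intro t
    have e := exp_mul_exp_neg (t • B)
    rw [← smul_neg] at e
    calc _ = exp (t • B) * exp ((2 : ℝ) • A) * (exp (t • B) * exp (t • -B)) *
          exp (-((2 : ℝ) • A)) * exp (t • -B) := by simp only [mul_assoc]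
      _ = exp (t • B) * (exp ((2 : ℝ) • A) * exp (-((2 : ℝ) • A))) * exp (t • -B) := by
          rw [e]; simp only [mul_assoc, mul_one]
      _ = 1 := by rw [exp_mul_exp_neg, mul_one, e]
  · intro t
    obtain ⟨A', h1, h2, h3⟩ := hmin t
    refine ⟨(2 : ℝ) • A', by simp [h1], ?_, ?_⟩
    · rw [← exp_mul_self, ← exp_mul_self, h2]
    · simp only [smul_mul_smul_comm, Matrix.trace_smul, smul_eq_mul]
      linarith

theorem trace_mul_eq_zero_of_min_left {A B : Matrix (Fin m) (Fin m) ℝ} (hA : Aᵀ = A)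
    (hmin : ∀ t : ℝ, ∃ A' : Matrix (Fin m) (Fin m) ℝ, A'ᵀ = A' ∧
      exp A' * exp A' = exp A * (exp (t • B) * exp (t • B)) * exp A ∧
      Matrix.trace (A * A) ≤ Matrix.trace (A' * A')) :
    Matrix.trace (A * B) = 0 := by
  have hd := hasDerivAt_exp_smul_zero B
  have hd' := hasDerivAt_exp_smul_zero (-B)
  have key := trace_mul_deriv_eq_zero_of_min (L := (2 : ℝ) • A)
    (Q := fun t => exp A * (exp (t • B) * exp (t • B)) * exp A)
    (R := fun t => exp (-A) * (exp (t • -B) * exp (t • -B)) * exp (-A))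
    (by simp [hA]) (((hd.mul hd).const_mul _).mul_const _)
    (((hd'.mul hd').const_mul _).mul_const _) ?_ (by simp [exp_mul_self]) ?_
  · simp only [zero_smul, NormedSpace.exp_zero, mul_one, one_mul] at key
    have h2 : exp (-((2 : ℝ) • A)) = exp (-A) * exp (-A) := by rw [exp_mul_self, smul_neg]
    have hc : Commute (exp A) ((2 : ℝ) • A) := ((Commute.refl A).exp_left).smul_right _
    have e : exp A * ((2 : ℝ) • A * (exp (-A) * exp (-A)) * (exp A * (B + B))) =
        (4 : ℝ) • (A * B) := by
      calc _ = (2 : ℝ) • A * (exp A * exp (-A)) * (exp (-A) * exp A) * (B + B) := by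
            simp only [← mul_assoc]; rw [hc.eq]
        _ = _ := by
            rw [exp_mul_exp_neg, exp_neg_mul_exp, mul_one, mul_one, ← two_smul ℝ B,
              smul_mul_smul_comm]; norm_num
    rw [h2, ← mul_assoc, Matrix.trace_mul_comm, e, Matrix.trace_smul] at key
    simp only [smul_eq_mul] at key
    linarith
  · intro t
    have e := exp_mul_exp_neg (t • B)
    rw [← smul_neg] at e
    calc _ = exp A * exp (t • B) * exp (t • B) * (exp A * exp (-A)) * exp (t • -B) *
          exp (t • -B) * exp (-A) := by simp only [mul_assoc]
      _ = exp A * exp (t • B) * (exp (t • B) * exp (t • -B)) * exp (t • -B) * exp (-A) := by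
          rw [exp_mul_exp_neg]; simp only [mul_assoc, mul_one]
      _ = exp A * (exp (t • B) * exp (t • -B)) * exp (-A) := by
          rw [e, mul_one, mul_assoc (exp A), e]
      _ = 1 := by rw [e, mul_one, exp_mul_exp_neg]
  · intro t
    obtain ⟨A', h1, h2, h3⟩ := hmin t
    refine ⟨(2 : ℝ) • A', by simp [h1], ?_, ?_⟩
    · rw [← exp_mul_self, h2]
    · simp only [smul_mul_smul_comm, Matrix.trace_smul, smul_eq_mul]
      linarith

end Variation

section Brackets

variable {m : ℕ}

theorem IsSkewBilin.add_left {μ : Vm m} (h : IsSkewBilin μ) (X X' Y : Fin m → ℝ) :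
    μ (X + X') Y = μ X Y + μ X' Y := by
  simpa using h.1 1 X X' Y

theorem IsSkewBilin.add_right {μ : Vm m} (h : IsSkewBilin μ) (X Y Y' : Fin m → ℝ) :
    μ X (Y + Y') = μ X Y + μ X Y' := by
  simpa using h.2.1 1 X Y Y'

theorem IsSkewBilin.smul_left {μ : Vm m} (h : IsSkewBilin μ) (c : ℝ) (X Y : Fin m → ℝ) :
    μ (c • X) Y = c • μ X Y := by
  have h0 : μ 0 Y = 0 := by simpa using h.add_left 0 0 Y
  simpa [h0] using h.1 c X 0 Y

theorem IsSkewBilin.smul_right {μ : Vm m} (h : IsSkewBilin μ) (c : ℝ) (X Y : Fin m → ℝ) :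
    μ X (c • Y) = c • μ X Y := by
  have h0 : μ X 0 = 0 := by simpa using h.add_right X 0 0
  simpa [h0] using h.2.1 c X Y 0

/-- A bracket as a bundled bilinear map. -/
noncomputable def IsSkewBilin.toLin {μ : Vm m} (h : IsSkewBilin μ) :
    (Fin m → ℝ) →ₗ[ℝ] (Fin m → ℝ) →ₗ[ℝ] (Fin m → ℝ) :=
  LinearMap.mk₂ ℝ μ h.add_left h.smul_left h.add_right h.smul_right

theorem IsSkewBilin.toLin_apply {μ : Vm m} (h : IsSkewBilin μ) (X Y : Fin m → ℝ) :
    h.toLin X Y = μ X Y := rfl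

theorem eq_sum_smul_stdb (X : Fin m → ℝ) : X = ∑ i, X i • stdb m i := by
  ext j
  simp [stdb, Finset.sum_apply, Pi.single_apply]

theorem IsSkewBilin.apply_eq_sum_left {μ : Vm m} (h : IsSkewBilin μ) (X Y : Fin m → ℝ) :
    μ X Y = ∑ i, X i • μ (stdb m i) Y := by
  conv_lhs => rw [← h.toLin_apply, eq_sum_smul_stdb X]
  simp [h.toLin_apply]

theorem IsSkewBilin.apply_eq_sum_right {μ : Vm m} (h : IsSkewBilin μ) (X Y : Fin m → ℝ) :
    μ X Y = ∑ i, Y i • μ X (stdb m i) := by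
  conv_lhs => rw [← h.toLin_apply, eq_sum_smul_stdb Y, map_sum]
  exact Finset.sum_congr rfl fun i _ => by rw [map_smul, h.toLin_apply]

theorem IsSkewBilin.ext {μ ν : Vm m} (hμ : IsSkewBilin μ) (hν : IsSkewBilin ν)
    (h : ∀ i j k, μ (stdb m i) (stdb m j) k = ν (stdb m i) (stdb m j) k) : μ = ν := by
  funext X Y
  rw [hμ.apply_eq_sum_left, hν.apply_eq_sum_left]
  refine Finset.sum_congr rfl fun i _ => ?_
  rw [hμ.apply_eq_sum_right, hν.apply_eq_sum_right]
  exact congrArg _ (Finset.sum_congr rfl fun j _ => congrArg _ (funext (h i j)))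

theorem IsSkewBilin.smul {μ : Vm m} (h : IsSkewBilin μ) (r : ℝ) : IsSkewBilin (r • μ) := by
  refine ⟨fun c X X' Y => ?_, fun c X Y Y' => ?_, fun X Y => ?_⟩
  · simp only [Pi.smul_apply, h.1, smul_add, smul_comm r c]
  · simp only [Pi.smul_apply, h.2.1, smul_add, smul_comm r c]
  · simp only [Pi.smul_apply]
    rw [h.2.2, smul_neg]

/-- The bracket `p μ(q X, q Y)`. -/
def conjBrk (p q : Matrix (Fin m) (Fin m) ℝ) (μ : Vm m) : Vm m :=
  fun X Y => p *ᵥ μ (q *ᵥ X) (q *ᵥ Y)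

theorem conjBrk_conjBrk (p q p' q' : Matrix (Fin m) (Fin m) ℝ) (μ : Vm m) :
    conjBrk p q (conjBrk p' q' μ) = conjBrk (p * p') (q' * q) μ := by
  funext X Y
  simp only [conjBrk, Matrix.mulVec_mulVec]

theorem conjBrk_one (μ : Vm m) : conjBrk 1 1 μ = μ := by
  funext X Y
  simp only [conjBrk, Matrix.one_mulVec]

theorem conjBrk_smul (p q : Matrix (Fin m) (Fin m) ℝ) (r : ℝ) (μ : Vm m) :
    conjBrk p q (r • μ) = r • conjBrk p q μ := by
  funext X Y
  simp only [conjBrk, Pi.smul_apply, Matrix.mulVec_smul]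

theorem IsSkewBilin.conjBrk {μ : Vm m} (h : IsSkewBilin μ) (p q : Matrix (Fin m) (Fin m) ℝ) :
    IsSkewBilin (conjBrk p q μ) := by
  refine ⟨fun c X X' Y => ?_, fun c X Y Y' => ?_, fun X Y => ?_⟩
  · simp only [_root_.conjBrk, Matrix.mulVec_add, Matrix.mulVec_smul, h.1]
  · simp only [_root_.conjBrk, Matrix.mulVec_add, Matrix.mulVec_smul, h.2.1]
  · simp only [_root_.conjBrk]
    rw [h.2.2, Matrix.mulVec_neg]

/-- The infinitesimal action of a matrix on a bracket. -/
def infAct (A : Matrix (Fin m) (Fin m) ℝ) (μ : Vm m) : Vm m :=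
  fun X Y => A *ᵥ μ X Y - μ (A *ᵥ X) Y - μ X (A *ᵥ Y)

theorem infAct_smul_right (A : Matrix (Fin m) (Fin m) ℝ) (r : ℝ) (μ : Vm m) :
    infAct A (r • μ) = r • infAct A μ := by
  funext X Y
  simp only [infAct, Pi.smul_apply, Matrix.mulVec_smul, smul_sub]

theorem infAct_smul_left {μ : Vm m} (h : IsSkewBilin μ) (r : ℝ)
    (A : Matrix (Fin m) (Fin m) ℝ) : infAct (r • A) μ = r • infAct A μ := by
  funext X Y
  simp only [infAct, Pi.smul_apply, Matrix.smul_mulVec, h.smul_left, h.smul_right, smul_sub]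

theorem infAct_smul_one_add {μ : Vm m} (h : IsSkewBilin μ) (c : ℝ)
    {D : Matrix (Fin m) (Fin m) ℝ} (hD : IsDeriv μ D) :
    infAct (c • (1 : Matrix (Fin m) (Fin m) ℝ) + D) μ = (-c) • μ := by
  funext X Y
  simp only [infAct, Pi.smul_apply, Matrix.add_mulVec, Matrix.smul_mulVec, Matrix.one_mulVec,
    h.add_left, h.add_right, h.smul_left, h.smul_right, hD X Y, neg_smul]
  abel

theorem conjBrk_infAct (A : Matrix (Fin m) (Fin m) ℝ) {p q : Matrix (Fin m) (Fin m) ℝ}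
    (hqp : q * p = 1) (μ : Vm m) :
    conjBrk p q (infAct A μ) = infAct (p * A * q) (conjBrk p q μ) := by
  funext X Y
  simp only [conjBrk, infAct, Matrix.mulVec_sub, Matrix.mulVec_mulVec, mul_assoc, hqp, mul_one]
  simp only [← mul_assoc, hqp, one_mul]

theorem infAct_diagonal {μ : Vm m} (h : IsSkewBilin μ) (a : Fin m → ℝ) (i j k : Fin m) :
    infAct (Matrix.diagonal a) μ (stdb m i) (stdb m j) k =
      (a k - a i - a j) * μ (stdb m i) (stdb m j) k := by
  have hs : ∀ i, Matrix.diagonal a *ᵥ stdb m i = a i • stdb m i := by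
    intro i
    rw [stdb, Matrix.diagonal_mulVec_single, ← Pi.single_smul, smul_eq_mul]
  simp only [infAct, hs, h.smul_left, h.smul_right, Pi.sub_apply, Matrix.mulVec_diagonal,
    Pi.smul_apply, smul_eq_mul]
  ring

theorem conjBrk_diagonal {μ : Vm m} (h : IsSkewBilin μ) (x y : Fin m → ℝ) (i j k : Fin m) :
    conjBrk (Matrix.diagonal x) (Matrix.diagonal y) μ (stdb m i) (stdb m j) k =
      x k * (y i * y j) * μ (stdb m i) (stdb m j) k := by
  have hs : ∀ i, Matrix.diagonal y *ᵥ stdb m i = y i • stdb m i := by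
    intro i
    rw [stdb, Matrix.diagonal_mulVec_single, ← Pi.single_smul, smul_eq_mul]
  simp only [conjBrk, hs, h.smul_left, h.smul_right, Matrix.mulVec_diagonal,
    Pi.smul_apply, smul_eq_mul]
  ring

/-- The inner product on brackets. -/
noncomputable def brkInner (μ ν : Vm m) : ℝ :=
  ∑ i, ∑ j, μ (stdb m i) (stdb m j) ⬝ᵥ ν (stdb m i) (stdb m j)

theorem brkInner_smul_smul (r : ℝ) (μ ν : Vm m) :
    brkInner (r • μ) (r • ν) = r ^ 2 * brkInner μ ν := by
  simp only [brkInner, Pi.smul_apply, smul_dotProduct, dotProduct_smul, Finset.mul_sum, smul_eq_mul]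
  exact Finset.sum_congr rfl fun i _ => Finset.sum_congr rfl fun j _ => by ring

theorem sum_apply_orthogonal {V : Type*} [AddCommGroup V] [Module ℝ V]
    (B : (Fin m → ℝ) →ₗ[ℝ] (Fin m → ℝ) →ₗ[ℝ] V) {U : Matrix (Fin m) (Fin m) ℝ}
    (hU : U * Uᵀ = 1) :
    ∑ i, B (U *ᵥ stdb m i) (U *ᵥ stdb m i) = ∑ i, B (stdb m i) (stdb m i) := by
  have hs : ∀ i, U *ᵥ stdb m i = ∑ p, U p i • stdb m p := by
    intro i
    rw [eq_sum_smul_stdb (U *ᵥ stdb m i)]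
    simp [stdb]
  simp only [hs, map_sum, map_smul, LinearMap.sum_apply, LinearMap.smul_apply, Finset.smul_sum]
  rw [Finset.sum_comm]
  have hc : ∀ p q, ∑ i, U p i * U q i = if p = q then 1 else 0 := by
    intro p q
    have := congrFun (congrFun hU p) q
    rwa [Matrix.mul_apply, Matrix.one_apply] at this
  calc _ = ∑ p, ∑ q, (∑ i, U p i * U q i) • B (stdb m q) (stdb m p) := by
        refine Finset.sum_congr rfl fun p _ => ?_
        rw [Finset.sum_comm]
        refine Finset.sum_congr rfl fun q _ => ?_
        rw [Finset.sum_smul]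
        exact Finset.sum_congr rfl fun i _ => by rw [smul_smul]
    _ = _ := by simp [hc]

theorem brkInner_conjBrk {μ ν : Vm m} (hμ : IsSkewBilin μ)
    (hν : IsSkewBilin ν) {U : Matrix (Fin m) (Fin m) ℝ} (hU : U * Uᵀ = 1) :
    brkInner (conjBrk Uᵀ U μ) (conjBrk Uᵀ U ν) = brkInner μ ν := by
  have hdot : ∀ v w : Fin m → ℝ, (Uᵀ *ᵥ v) ⬝ᵥ (Uᵀ *ᵥ w) = v ⬝ᵥ w := by
    intro v w
    rw [Matrix.dotProduct_mulVec, Matrix.vecMul_transpose, Matrix.mulVec_mulVec, hU,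
      Matrix.one_mulVec]
  simp only [brkInner, conjBrk, hdot]
  let dot : (Fin m → ℝ) →ₗ[ℝ] (Fin m → ℝ) →ₗ[ℝ] ℝ := dotProductBilin ℝ ℝ
  have h1 : ∀ X, ∑ j, μ X (U *ᵥ stdb m j) ⬝ᵥ ν X (U *ᵥ stdb m j) =
      ∑ j, μ X (stdb m j) ⬝ᵥ ν X (stdb m j) := fun X =>
    sum_apply_orthogonal (dot.compl₁₂ (hμ.toLin X) (hν.toLin X)) hU
  simp only [h1]
  rw [Finset.sum_comm]
  conv_rhs => rw [Finset.sum_comm]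
  refine Finset.sum_congr rfl fun j _ => ?_
  exact sum_apply_orthogonal (dot.compl₁₂ (hμ.toLin.flip (stdb m j)) (hν.toLin.flip (stdb m j))) hU

theorem IsSkewBilin.infAct {μ : Vm m} (h : IsSkewBilin μ) (A : Matrix (Fin m) (Fin m) ℝ) :
    IsSkewBilin (infAct A μ) := by
  refine ⟨fun c X X' Y => ?_, fun c X Y Y' => ?_, fun X Y => ?_⟩
  · simp only [_root_.infAct, Matrix.mulVec_add, Matrix.mulVec_smul, h.1, smul_sub]
    abel
  · simp only [_root_.infAct, Matrix.mulVec_add, Matrix.mulVec_smul, h.2.1, smul_sub]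
    abel
  · simp only [_root_.infAct]
    rw [h.2.2 X Y, h.2.2 _ Y, h.2.2 X, Matrix.mulVec_neg]
    abel

theorem sum_comm_pairs (f : Fin m → Fin m → Fin m → Fin m → ℝ) :
    ∑ i, ∑ j, ∑ x, ∑ y, f i j x y = ∑ x, ∑ y, ∑ i, ∑ j, f i j x y :=
  calc _ = ∑ p : Fin m × Fin m, ∑ q : Fin m × Fin m, f p.1 p.2 q.1 q.2 := by
        simp only [Fintype.sum_prod_type]
    _ = _ := by
        rw [Finset.sum_comm]
        simp only [Fintype.sum_prod_type]

theorem trace_Ric_mul {μ : Vm m} (h : IsSkewBilin μ) {A : Matrix (Fin m) (Fin m) ℝ}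
    (hA : Aᵀ = A) : Matrix.trace (Ric μ * A) = 1 / 4 * brkInner (infAct A μ) μ := by
  have hAs : ∀ x y, A x y = A y x := fun x y => congrFun (congrFun hA y) x
  have e1 : ∀ i Y, μ (A *ᵥ stdb m i) Y = ∑ p, A p i • μ (stdb m p) Y := by
    intro i Y
    rw [h.apply_eq_sum_left]
    simp [stdb]
  have s1 : ∑ i, ∑ j, (A *ᵥ μ (stdb m i) (stdb m j)) ⬝ᵥ μ (stdb m i) (stdb m j) =
      ∑ x, ∑ y, A x y * ∑ i, ∑ j, μ (stdb m i) (stdb m j) x * μ (stdb m i) (stdb m j) y := by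
    simp only [dotProduct, Matrix.mulVec, Finset.sum_mul, Finset.mul_sum]
    rw [sum_comm_pairs]
    refine Finset.sum_congr rfl fun x _ => Finset.sum_congr rfl fun y _ =>
      Finset.sum_congr rfl fun i _ => Finset.sum_congr rfl fun j _ => by ring
  have s2 : ∑ i, ∑ j, μ (A *ᵥ stdb m i) (stdb m j) ⬝ᵥ μ (stdb m i) (stdb m j) =
      ∑ x, ∑ y, A x y * ∑ i, ∑ j, μ (stdb m x) (stdb m i) j * μ (stdb m y) (stdb m i) j := by
    simp only [e1, dotProduct, Finset.sum_apply, Pi.smul_apply, smul_eq_mul, Finset.mul_sum,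
      Finset.sum_mul]
    calc _ = ∑ y, ∑ i, ∑ x, ∑ j,
          A x y * (μ (stdb m x) (stdb m i) j * μ (stdb m y) (stdb m i) j) := by
          refine Finset.sum_congr rfl fun y _ => Finset.sum_congr rfl fun i _ => ?_
          rw [Finset.sum_comm]
          refine Finset.sum_congr rfl fun x _ => Finset.sum_congr rfl fun j _ => by ring
      _ = ∑ y, ∑ x, ∑ i, ∑ j,
          A x y * (μ (stdb m x) (stdb m i) j * μ (stdb m y) (stdb m i) j) :=
          Finset.sum_congr rfl fun y _ => Finset.sum_comm
      _ = _ := Finset.sum_comm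
  have s3 : ∑ i, ∑ j, μ (stdb m i) (A *ᵥ stdb m j) ⬝ᵥ μ (stdb m i) (stdb m j) =
      ∑ i, ∑ j, μ (A *ᵥ stdb m i) (stdb m j) ⬝ᵥ μ (stdb m i) (stdb m j) := by
    rw [Finset.sum_comm]
    refine Finset.sum_congr rfl fun i _ => Finset.sum_congr rfl fun j _ => ?_
    rw [h.2.2, h.2.2 (stdb m j) (stdb m i), neg_dotProduct_neg]
  simp only [brkInner, infAct, sub_dotProduct, Finset.sum_sub_distrib]
  rw [s3, s2, s1]
  simp only [Matrix.trace, Matrix.diag, Matrix.mul_apply, Ric, Matrix.of_apply]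
  rw [← Finset.sum_sub_distrib, ← Finset.sum_sub_distrib, Finset.mul_sum]
  refine Finset.sum_congr rfl fun x _ => ?_
  rw [← Finset.sum_sub_distrib, ← Finset.sum_sub_distrib, Finset.mul_sum]
  refine Finset.sum_congr rfl fun y _ => ?_
  rw [hAs y x]
  ring

theorem exists_conjBrk_exp {A : Matrix (Fin m) (Fin m) ℝ} (hA : Aᵀ = A) (μ : Vm m) :
    ∃ (U : Matrix (Fin m) (Fin m) ℝ) (a : Fin m → ℝ), Uᵀ * U = 1 ∧ U * Uᵀ = 1 ∧
      Uᵀ * A * U = Matrix.diagonal a ∧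
      conjBrk Uᵀ U (conjBrk (exp A) (exp (-A)) μ) =
        conjBrk (Matrix.diagonal fun i => Real.exp (a i))
          (Matrix.diagonal fun i => Real.exp (-a i)) (conjBrk Uᵀ U μ) := by
  obtain ⟨U, a, hU, hU', rfl⟩ := exists_orthogonal_diagonal hA
  refine ⟨U, a, hU, hU', ?_, ?_⟩
  · calc _ = (Uᵀ * U) * Matrix.diagonal a * (Uᵀ * U) := by simp only [mul_assoc]
      _ = _ := by rw [hU, one_mul, mul_one]
  · have hn : -(U * Matrix.diagonal a * Uᵀ) = U * Matrix.diagonal (fun i => -a i) * Uᵀ := by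
      have : Matrix.diagonal (fun i => -a i) = -Matrix.diagonal a := (Matrix.diagonal_neg a).symm
      rw [this, mul_neg, neg_mul]
    rw [hn, exp_orthogonal_conj_diagonal hU', exp_orthogonal_conj_diagonal hU', conjBrk_conjBrk,
      conjBrk_conjBrk]
    congr 1
    · rw [← mul_assoc, ← mul_assoc, hU, one_mul]
    · rw [mul_assoc, hU, mul_one]

theorem conjBrk_orthogonal_injective {U : Matrix (Fin m) (Fin m) ℝ} (hU' : U * Uᵀ = 1)
    {μ ν : Vm m} (h : conjBrk Uᵀ U μ = conjBrk Uᵀ U ν) : μ = ν := by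
  have := congrArg (conjBrk U Uᵀ) h
  rwa [conjBrk_conjBrk, conjBrk_conjBrk, hU', conjBrk_one, conjBrk_one] at this

/-- An eigenvector of the infinitesimal action is an eigenvector of the exponential. -/
theorem conjBrk_exp_of_infAct {μ : Vm m} (h : IsSkewBilin μ) {B : Matrix (Fin m) (Fin m) ℝ}
    (hB : Bᵀ = B) {c : ℝ} (hc : infAct B μ = c • μ) :
    conjBrk (exp B) (exp (-B)) μ = Real.exp c • μ := by
  obtain ⟨U, b, hU, hU', hd, he⟩ := exists_conjBrk_exp hB μ
  refine conjBrk_orthogonal_injective hU' ?_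
  have ht := h.conjBrk Uᵀ U
  have hc' := congrArg (conjBrk Uᵀ U) hc
  rw [conjBrk_infAct B hU', hd, conjBrk_smul] at hc'
  rw [he, conjBrk_smul]
  refine (ht.conjBrk _ _).ext (ht.smul _) fun i j k => ?_
  rw [conjBrk_diagonal ht]
  have hw := infAct_diagonal ht b i j k
  rw [hc'] at hw
  simp only [Pi.smul_apply, smul_eq_mul] at hw ⊢
  rcases mul_eq_mul_right_iff.1 hw with h1 | h1
  · rw [h1, ← Real.exp_add, ← Real.exp_add]
    ring_nf
  · rw [h1, mul_zero, mul_zero]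

/-- If the derivative of `t ↦ ‖exp (t A) · μ‖²` vanishes at `0` and at `1`, then `exp A` fixes
`μ`. -/
theorem conjBrk_exp_eq_self {μ : Vm m} (h : IsSkewBilin μ) {A : Matrix (Fin m) (Fin m) ℝ}
    (hA : Aᵀ = A) (h0 : brkInner (infAct A μ) μ = 0)
    (h1 : brkInner (infAct A (conjBrk (exp A) (exp (-A)) μ)) (conjBrk (exp A) (exp (-A)) μ) = 0) :
    conjBrk (exp A) (exp (-A)) μ = μ := by
  obtain ⟨U, a, hU, hU', hd, he⟩ := exists_conjBrk_exp hA μ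
  refine conjBrk_orthogonal_injective hU' ?_
  have hμ' := h.conjBrk (exp A) (exp (-A))
  have ht := h.conjBrk Uᵀ U
  rw [← brkInner_conjBrk (h.infAct A) h hU', conjBrk_infAct A hU', hd] at h0
  rw [← brkInner_conjBrk (hμ'.infAct A) hμ' hU', conjBrk_infAct A hU', hd, he] at h1
  rw [he]
  set t := conjBrk Uᵀ U μ
  have ht' := ht.conjBrk (Matrix.diagonal fun i => Real.exp (a i))
    (Matrix.diagonal fun i => Real.exp (-a i))
  have key : ∀ i j k, (a k - a i - a j) * t (stdb m i) (stdb m j) k ^ 2 *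
      (Real.exp (2 * (a k - a i - a j)) - 1) = 0 := by
    have hnn : ∀ i j k, 0 ≤ (a k - a i - a j) * t (stdb m i) (stdb m j) k ^ 2 *
        (Real.exp (2 * (a k - a i - a j)) - 1) := by
      intro i j k
      have hw : 0 ≤ (a k - a i - a j) * (Real.exp (2 * (a k - a i - a j)) - 1) := by
        rcases le_total 0 (a k - a i - a j) with hw | hw
        · have h5 := Real.one_le_exp (x := 2 * (a k - a i - a j)) (by linarith)
          exact mul_nonneg hw (by linarith)
        · have h5 := Real.exp_le_one_iff.2 (show 2 * (a k - a i - a j) ≤ 0 by linarith)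
          exact mul_nonneg_of_nonpos_of_nonpos hw (by linarith)
      nlinarith [mul_nonneg hw (sq_nonneg (t (stdb m i) (stdb m j) k))]
    have hsum : ∑ i, ∑ j, ∑ k, (a k - a i - a j) * t (stdb m i) (stdb m j) k ^ 2 *
        (Real.exp (2 * (a k - a i - a j)) - 1) = 0 := by
      rw [← sub_zero (0 : ℝ)]
      nth_rewrite 1 [← h1]
      rw [← h0]
      simp only [brkInner, dotProduct, infAct_diagonal ht, infAct_diagonal ht',
        conjBrk_diagonal ht, ← Finset.sum_sub_distrib]
      refine Finset.sum_congr rfl fun i _ => Finset.sum_congr rfl fun j _ =>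
        Finset.sum_congr rfl fun k _ => ?_
      have e : Real.exp (2 * (a k - a i - a j)) =
          (Real.exp (a k) * (Real.exp (-a i) * Real.exp (-a j))) ^ 2 := by
        rw [← Real.exp_add, ← Real.exp_add, ← Real.exp_nat_mul]
        congr 1
        push_cast
        ring
      rw [e]
      ring
    intro i j k
    have hi := (Finset.sum_eq_zero_iff_of_nonneg fun i _ => Finset.sum_nonneg fun j _ =>
      Finset.sum_nonneg fun k _ => hnn i j k).1 hsum i (Finset.mem_univ i)
    have hj := (Finset.sum_eq_zero_iff_of_nonneg fun j _ =>
      Finset.sum_nonneg fun k _ => hnn i j k).1 hi j (Finset.mem_univ j)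
    exact (Finset.sum_eq_zero_iff_of_nonneg fun k _ => hnn i j k).1 hj k (Finset.mem_univ k)
  refine ht'.ext ht fun i j k => ?_
  rw [conjBrk_diagonal ht]
  have e : Real.exp (a k) * (Real.exp (-a i) * Real.exp (-a j)) = Real.exp (a k - a i - a j) := by
    rw [← Real.exp_add, ← Real.exp_add]
    ring_nf
  rw [e]
  rcases mul_eq_zero.1 (key i j k) with h2 | h2
  · rcases mul_eq_zero.1 h2 with h3 | h3
    · rw [h3, Real.exp_zero, one_mul]
    · rw [pow_eq_zero_iff two_ne_zero] at h3
      rw [h3, mul_zero]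
  · have h3 : 2 * (a k - a i - a j) = 0 := by
      rw [← Real.exp_eq_one_iff]
      linarith
    have h4 : a k - a i - a j = 0 := by linarith
    rw [h4, Real.exp_zero, one_mul]

end Brackets

section Minimization

variable {m : ℕ} {J : Matrix (Fin m) (Fin m) ℝ}

theorem exp_transpose_of_symm {A : Matrix (Fin m) (Fin m) ℝ} (hA : Aᵀ = A) :
    (exp A)ᵀ = exp A := by
  rw [← Matrix.exp_transpose, hA]

theorem symplectic_exp (hJ : J * J = -1) {A : Matrix (Fin m) (Fin m) ℝ} (hA : Aᵀ = A)
    (hAJ : A * J = -(J * A)) : (exp A)ᵀ * J * exp A = J := by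
  rw [exp_transpose_of_symm hA, exp_mul_of_anticommute hJ hAJ, mul_assoc, exp_neg_mul_exp, mul_one]

theorem symplectic_mul {g h : Matrix (Fin m) (Fin m) ℝ} (hg : gᵀ * J * g = J)
    (hh : hᵀ * J * h = J) : (g * h)ᵀ * J * (g * h) = J := by
  calc _ = hᵀ * (gᵀ * J * g) * h := by rw [Matrix.transpose_mul]; simp only [mul_assoc]
    _ = J := by rw [hg, hh]

/-- The pair `(k, A)` consists of a unitary `k` and a symmetric `A` anticommuting with `J` such that
`k * exp A` maps the bracket `μ` into the line spanned by `ν`. -/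
def IsPolarPair (J : Matrix (Fin m) (Fin m) ℝ) (μ ν : Vm m)
    (p : Matrix (Fin m) (Fin m) ℝ × Matrix (Fin m) (Fin m) ℝ) : Prop :=
  p.1ᵀ * p.1 = 1 ∧ p.1ᵀ * J * p.1 = J ∧ p.2ᵀ = p.2 ∧ p.2 * J = -(J * p.2) ∧
    ∃ r : ℝ, conjBrk (p.1 * exp p.2) (exp (-p.2) * p.1ᵀ) μ = r • ν

theorem exists_isPolarPair (hJ : J * J = -1) (hJt : Jᵀ = -J) {μ ν : Vm m}
    {h h' : Matrix (Fin m) (Fin m) ℝ} (hh : h * h' = 1) (hs : hᵀ * J * h = J) {r : ℝ}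
    (hr : conjBrk h h' μ = r • ν) :
    ∃ k A, IsPolarPair J μ ν (k, A) ∧ exp A * exp A = hᵀ * h := by
  obtain ⟨A, hA, hAJ, hg⟩ := exists_log_gram hJ hJt hs
  have hnA : (-A)ᵀ = -A := by rw [Matrix.transpose_neg, hA]
  have hnAJ : -A * J = -(J * -A) := by rw [neg_mul, hAJ, mul_neg]
  have hk : (h * exp (-A))ᵀ * (h * exp (-A)) = 1 := by
    rw [Matrix.transpose_mul, exp_transpose_of_symm hnA]
    calc _ = exp (-A) * (hᵀ * h) * exp (-A) := by simp only [mul_assoc]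
      _ = (exp (-A) * exp A) * (exp A * exp (-A)) := by rw [← hg]; simp only [mul_assoc]
      _ = 1 := by rw [exp_neg_mul_exp, exp_mul_exp_neg, one_mul]
  have hkA : h * exp (-A) * exp A = h := by rw [mul_assoc, exp_neg_mul_exp, mul_one]
  refine ⟨h * exp (-A), A, ⟨hk, symplectic_mul hs (symplectic_exp hJ hnA hnAJ), hA, hAJ, r, ?_⟩, hg⟩
  have hinv : exp (-A) * (h * exp (-A))ᵀ = h' := by
    have h1 : (exp (-A) * (h * exp (-A))ᵀ) * h = 1 := by
      nth_rewrite 2 [← hkA]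
      calc _ = exp (-A) * ((h * exp (-A))ᵀ * (h * exp (-A))) * exp A := by simp only [mul_assoc]
        _ = 1 := by rw [hk, mul_one, exp_neg_mul_exp]
    calc _ = (exp (-A) * (h * exp (-A))ᵀ) * (h * h') := by rw [hh, mul_one]
      _ = h' := by rw [← mul_assoc, h1, one_mul]
  simp only [hkA, hinv, hr]

theorem continuous_matrix_exp :
    Continuous (exp : Matrix (Fin m) (Fin m) ℝ → Matrix (Fin m) (Fin m) ℝ) := by
  open scoped Matrix.Norms.Operator in
  exact NormedSpace.exp_continuous

theorem IsSkewBilin.apply_eq_sum {μ : Vm m} (h : IsSkewBilin μ) (X Y : Fin m → ℝ) :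
    μ X Y = ∑ i, X i • ∑ j, Y j • μ (stdb m i) (stdb m j) := by
  rw [h.apply_eq_sum_left]
  exact Finset.sum_congr rfl fun i _ => by rw [h.apply_eq_sum_right]

theorem IsSkewBilin.continuous_conjBrk {μ : Vm m} (h : IsSkewBilin μ) :
    Continuous fun p : Matrix (Fin m) (Fin m) ℝ × Matrix (Fin m) (Fin m) ℝ =>
      _root_.conjBrk p.1 p.2 μ := by
  refine continuous_pi fun X => continuous_pi fun Y => ?_
  refine continuous_fst.matrix_mulVec ?_
  simp only [h.apply_eq_sum (_ *ᵥ X)]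
  have hc : ∀ X : Fin m → ℝ,
      Continuous fun p : Matrix (Fin m) (Fin m) ℝ × Matrix (Fin m) (Fin m) ℝ => p.2 *ᵥ X :=
    fun X => continuous_snd.matrix_mulVec continuous_const
  refine continuous_finsetSum _ fun i _ => ?_
  refine ((continuous_apply i).comp (hc X)).smul ?_
  refine continuous_finsetSum _ fun j _ => ?_
  exact ((continuous_apply j).comp (hc Y)).smul continuous_const

theorem isClosed_isPolarPair {μ : Vm m} (h : IsSkewBilin μ) (ν : Vm m) :
    IsClosed {p | IsPolarPair J μ ν p} := by
  have h1 : Continuous fun p : Matrix (Fin m) (Fin m) ℝ × Matrix (Fin m) (Fin m) ℝ => p.1 :=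
    continuous_fst
  have h2 : Continuous fun p : Matrix (Fin m) (Fin m) ℝ × Matrix (Fin m) (Fin m) ℝ => p.2 :=
    continuous_snd
  refine (isClosed_eq (h1.matrix_transpose.mul h1) continuous_const).inter <|
    (isClosed_eq ((h1.matrix_transpose.mul continuous_const).mul h1) continuous_const).inter <|
    (isClosed_eq h2.matrix_transpose h2).inter <|
    (isClosed_eq (h2.mul continuous_const) (continuous_const.mul h2).neg).inter ?_
  have hcl : IsClosed ((Submodule.span ℝ {ν} : Submodule ℝ (Vm m)) : Set (Vm m)) :=
    Submodule.closed_of_finiteDimensional _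
  have hc := hcl.preimage (h.continuous_conjBrk.comp
    ((h1.mul (continuous_matrix_exp.comp h2)).prodMk
      ((continuous_matrix_exp.comp h2.neg).mul h1.matrix_transpose)))
  refine (congrArg IsClosed (Set.ext fun p => ?_)).mp hc
  refine Submodule.mem_span_singleton.trans ?_
  exact exists_congr fun r => eq_comm

theorem sq_apply_le_trace (A : Matrix (Fin m) (Fin m) ℝ) (i j : Fin m) :
    A i j ^ 2 ≤ Matrix.trace (Aᵀ * A) := by
  have e : Matrix.trace (Aᵀ * A) = ∑ j, ∑ i, A i j ^ 2 := by
    simp only [Matrix.trace, Matrix.diag, Matrix.mul_apply, Matrix.transpose_apply, sq]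
  rw [e]
  calc A i j ^ 2 ≤ ∑ i, A i j ^ 2 :=
        Finset.single_le_sum (f := fun i => A i j ^ 2) (fun i _ => sq_nonneg _) (Finset.mem_univ i)
    _ ≤ _ := Finset.single_le_sum (f := fun j => ∑ i, A i j ^ 2)
        (fun j _ => Finset.sum_nonneg fun i _ => sq_nonneg _) (Finset.mem_univ j)

theorem isCompact_matrix_box (R : ℝ) :
    IsCompact {A : Matrix (Fin m) (Fin m) ℝ | ∀ i j, A i j ∈ Set.Icc (-R) R} := by
  have h : IsCompact (Set.pi Set.univ fun _ : Fin m => Set.pi Set.univ fun _ : Fin m =>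
      Set.Icc (-R) R) :=
    isCompact_univ_pi fun _ => isCompact_univ_pi fun _ => isCompact_Icc
  simp only [Set.pi, Set.mem_univ, true_imp_iff] at h
  exact h

theorem exists_min_isPolarPair {μ : Vm m} (h : IsSkewBilin μ) {ν : Vm m}
    (hne : ∃ p, IsPolarPair J μ ν p) :
    ∃ k A, IsPolarPair J μ ν (k, A) ∧
      ∀ p, IsPolarPair J μ ν p → Matrix.trace (A * A) ≤ Matrix.trace (p.2 * p.2) := by
  obtain ⟨p₀, hp₀⟩ := hne
  have hf : Continuous fun p : Matrix (Fin m) (Fin m) ℝ × Matrix (Fin m) (Fin m) ℝ =>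
      Matrix.trace (p.2 * p.2) := (continuous_snd.mul continuous_snd).matrix_trace
  set R := Matrix.trace (p₀.2 * p₀.2) with hR
  have hcl := (isClosed_isPolarPair (J := J) h ν).inter (isClosed_le hf (continuous_const (y := R)))
  have hbox : ∀ {A : Matrix (Fin m) (Fin m) ℝ} {T : ℝ}, Matrix.trace (Aᵀ * A) ≤ T →
      ∀ i j, A i j ∈ Set.Icc (-(T + 1)) (T + 1) := by
    intro A T hT i j
    have := (sq_apply_le_trace A i j).trans hT
    constructor <;> nlinarith [sq_nonneg (A i j), sq_nonneg (A i j - 1), sq_nonneg (A i j + 1)]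
  have hK : IsCompact ({p | IsPolarPair J μ ν p} ∩ {p | Matrix.trace (p.2 * p.2) ≤ R}) := by
    refine ((isCompact_matrix_box (Matrix.trace (1 : Matrix (Fin m) (Fin m) ℝ) + 1)).prod
      (isCompact_matrix_box (R + 1))).of_isClosed_subset hcl ?_
    rintro p ⟨hp, hpR⟩
    refine ⟨hbox (by rw [hp.1]), hbox ?_⟩
    rw [hp.2.2.1]
    exact hpR
  obtain ⟨p, hp, hmin⟩ := hK.exists_isMinOn ⟨p₀, hp₀, le_refl R⟩ hf.continuousOn
  refine ⟨p.1, p.2, hp.1, fun q hq => ?_⟩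
  rcases le_total (Matrix.trace (q.2 * q.2)) R with hqR | hqR
  · exact hmin ⟨hq, hqR⟩
  · exact le_trans hp.2 hqR

theorem exists_unitary_conjBrk_eq_smul (hJ : J * J = -1) (hJt : Jᵀ = -J) {μ ν : Vm m}
    (hμ : IsSkewBilin μ) (hν : IsSkewBilin ν) {β β' : Matrix (Fin m) (Fin m) ℝ}
    (hβ : βᵀ = β) (hβJ : β * J = -(J * β)) (hβ' : β'ᵀ = β') (hβJ' : β' * J = -(J * β'))
    {c c' : ℝ} (hc : infAct β μ = c • μ) (hc' : infAct β' ν = c' • ν)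
    (htr : ∀ A, A * J = -(J * A) → Matrix.trace (β * A) = Matrix.trace (Ric μ * A))
    (htr' : ∀ A, A * J = -(J * A) → Matrix.trace (β' * A) = Matrix.trace (Ric ν * A))
    (hne : ∃ p, IsPolarPair J μ ν p) :
    ∃ (k : Matrix (Fin m) (Fin m) ℝ) (r : ℝ), kᵀ * k = 1 ∧ kᵀ * J * k = J ∧
      conjBrk k kᵀ μ = r • ν := by
  obtain ⟨k, A, ⟨hk, hkJ, hA, hAJ, r, hr⟩, hmin⟩ := exists_min_isPolarPair hμ hne
  dsimp only at hk hkJ hA hAJ hr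
  have hk' : k * kᵀ = 1 := mul_eq_one_comm.1 hk
  have hkc : J * k = k * J := by
    calc J * k = k * kᵀ * J * k := by rw [hk', one_mul]
      _ = k * (kᵀ * J * k) := by simp only [mul_assoc]
      _ = k * J := by rw [hkJ]
  have hkc' : kᵀ * J = J * kᵀ := by
    calc kᵀ * J = kᵀ * J * (k * kᵀ) := by rw [hk', mul_one]
      _ = kᵀ * J * k * kᵀ := by simp only [mul_assoc]
      _ = J * kᵀ := by rw [hkJ]
  have hsymm : ∀ (t : ℝ) {B : Matrix (Fin m) (Fin m) ℝ}, Bᵀ = B → (t • B)ᵀ = t • B := by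
    intro t B hB
    rw [Matrix.transpose_smul, hB]
  have hanti : ∀ (t : ℝ) {B : Matrix (Fin m) (Fin m) ℝ}, B * J = -(J * B) →
      (t • B) * J = -(J * (t • B)) := by
    intro t B hB
    rw [smul_mul_assoc, hB, mul_smul_comm, smul_neg]
  have hinv : (k * exp A) * (exp (-A) * kᵀ) = 1 := by
    rw [mul_assoc, ← mul_assoc (exp A), exp_mul_exp_neg, one_mul, hk']
  have hscale : ∀ (t : ℝ) {ξ : Vm m} {B : Matrix (Fin m) (Fin m) ℝ} {d : ℝ}, IsSkewBilin ξ →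
      Bᵀ = B → infAct B ξ = d • ξ →
      conjBrk (exp (t • B)) (exp (-(t • B))) ξ = Real.exp (t * d) • ξ := by
    intro t ξ B d hξ hB hd
    refine conjBrk_exp_of_infAct hξ (hsymm t hB) ?_
    rw [infAct_smul_left hξ, hd, smul_smul]
  have hgram : (k * exp A)ᵀ * (k * exp A) = exp A * exp A := by
    rw [Matrix.transpose_mul, exp_transpose_of_symm hA, mul_assoc, ← mul_assoc kᵀ, hk, one_mul]
  have hright : Matrix.trace (A * β) = 0 := by
    refine trace_mul_eq_zero_of_min_right hA fun t => ?_
    have hs := symplectic_mul (symplectic_mul hkJ (symplectic_exp hJ hA hAJ))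
      (symplectic_exp hJ (hsymm t hβ) (hanti t hβJ))
    obtain ⟨k₁, A₁, hp, hg⟩ := exists_isPolarPair hJ hJt (μ := μ) (ν := ν)
      (h' := exp (-(t • β)) * (exp (-A) * kᵀ)) (r := Real.exp (t * c) * r) (by
        rw [mul_assoc, ← mul_assoc (exp (t • β)), exp_mul_exp_neg, one_mul, hinv]) hs (by
        rw [← conjBrk_conjBrk, hscale t hμ hβ hc, conjBrk_smul, hr, smul_smul])
    refine ⟨A₁, hp.2.2.1, ?_, hmin _ hp⟩
    rw [hg, Matrix.transpose_mul (k * exp A), exp_transpose_of_symm (hsymm t hβ), mul_assoc,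
      ← mul_assoc _ (k * exp A), hgram, mul_assoc (exp (t • β))]
  have hleft : Matrix.trace (A * (kᵀ * β' * k)) = 0 := by
    refine trace_mul_eq_zero_of_min_left hA fun t => ?_
    have hs := symplectic_mul (symplectic_exp hJ (hsymm t hβ') (hanti t hβJ'))
      (symplectic_mul hkJ (symplectic_exp hJ hA hAJ))
    obtain ⟨k₁, A₁, hp, hg⟩ := exists_isPolarPair hJ hJt (μ := μ) (ν := ν)
      (h' := (exp (-A) * kᵀ) * exp (-(t • β'))) (r := r * Real.exp (t * c')) (by
        rw [mul_assoc, ← mul_assoc (k * exp A), hinv, one_mul, exp_mul_exp_neg]) hs (by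
        rw [← conjBrk_conjBrk, hr, conjBrk_smul, hscale t hν hβ' hc', smul_smul])
    refine ⟨A₁, hp.2.2.1, ?_, hmin _ hp⟩
    have he : exp (t • (kᵀ * β' * k)) = kᵀ * exp (t • β') * k := by
      have := exp_orthogonal_conj (U := kᵀ) (by rw [Matrix.transpose_transpose, hk]) (t • β')
      rwa [Matrix.transpose_transpose, mul_smul_comm, smul_mul_assoc] at this
    rw [hg, he, Matrix.transpose_mul, Matrix.transpose_mul,
      exp_transpose_of_symm (hsymm t hβ'), exp_transpose_of_symm hA]
    calc _ = exp A * (kᵀ * exp (t • β') * 1 * (exp (t • β') * k)) * exp A := by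
          simp only [mul_assoc, mul_one]
      _ = _ := by rw [← hk']; simp only [mul_assoc]
  have h0 : brkInner (infAct A μ) μ = 0 := by
    have := trace_Ric_mul hμ hA
    rw [← htr A hAJ, Matrix.trace_mul_comm, hright] at this
    linarith
  have h1 : brkInner (infAct A (conjBrk kᵀ k ν)) (conjBrk kᵀ k ν) = 0 := by
    have hs : (k * A * kᵀ)ᵀ = k * A * kᵀ := by
      simp only [Matrix.transpose_mul, Matrix.transpose_transpose, hA, mul_assoc]
    have ha : (k * A * kᵀ) * J = -(J * (k * A * kᵀ)) := by
      calc _ = k * (A * J) * kᵀ := by rw [mul_assoc, hkc']; simp only [mul_assoc]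
        _ = -(k * J * A * kᵀ) := by rw [hAJ]; simp only [mul_neg, neg_mul, mul_assoc]
        _ = _ := by rw [← hkc]; simp only [mul_assoc]
    have ht := trace_Ric_mul hν hs
    have hcyc : Matrix.trace (β' * (k * A * kᵀ)) = Matrix.trace (A * (kᵀ * β' * k)) := by
      calc _ = Matrix.trace ((β' * k) * (A * kᵀ)) := by simp only [mul_assoc]
        _ = _ := by rw [Matrix.trace_mul_comm]; simp only [mul_assoc]
    rw [← htr' _ ha, hcyc, hleft, ← brkInner_conjBrk (hν.infAct _) hν hk',
      conjBrk_infAct _ hk'] at ht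
    have hu : kᵀ * (k * A * kᵀ) * k = A := by
      calc _ = (kᵀ * k) * A * (kᵀ * k) := by simp only [mul_assoc]
        _ = A := by rw [hk, one_mul, mul_one]
    rw [hu] at ht
    linarith
  have hμ' : conjBrk (exp A) (exp (-A)) μ = r • conjBrk kᵀ k ν := by
    rw [← conjBrk_smul, ← hr, conjBrk_conjBrk, ← mul_assoc, hk, one_mul, mul_assoc, hk, mul_one]
  have hfix := conjBrk_exp_eq_self hμ hA h0 (by
    rw [hμ', infAct_smul_right, brkInner_smul_smul, h1, mul_zero])
  refine ⟨k, r, hk, hkJ, ?_⟩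
  rw [← hr, ← conjBrk_conjBrk, hfix]

end Minimization

section Symplectic

variable {n : ℕ}

theorem Jst_transpose : (Jst n)ᵀ = -Jst n := by
  ext i j
  simp only [Jst, Matrix.transpose_apply, Matrix.of_apply, Matrix.neg_apply]
  split_ifs <;> first | omega | simp

theorem Jst_mul_self : Jst n * Jst n = -1 := by
  ext i j
  rw [Matrix.mul_apply, Finset.sum_eq_single (⟨2 * n - 1 - i, by omega⟩ : Fin (2 * n))]
  · simp only [Jst, Matrix.of_apply, Matrix.neg_apply, Matrix.one_apply, Fin.ext_iff]
    split_ifs <;> first | omega | simp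
  · intro b _ hb
    have : (i : ℕ) + b ≠ 2 * n - 1 := fun h => hb (Fin.ext (by simp only; omega))
    simp only [Jst, Matrix.of_apply, if_neg this, zero_mul]
  · intro h
    exact absurd (Finset.mem_univ _) h

theorem inSp_iff (g : GL (Fin (2 * n)) ℝ) :
    InSp n g ↔ (g : Matrix (Fin (2 * n)) (Fin (2 * n)) ℝ)ᵀ * Jst n *
      (g : Matrix (Fin (2 * n)) (Fin (2 * n)) ℝ) = Jst n := by
  have e : ∀ X Y : Fin (2 * n) → ℝ, omegaSt n ((g : Matrix _ _ ℝ) *ᵥ X) ((g : Matrix _ _ ℝ) *ᵥ Y) =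
      X ⬝ᵥ ((g : Matrix (Fin (2 * n)) (Fin (2 * n)) ℝ)ᵀ * Jst n *
        (g : Matrix (Fin (2 * n)) (Fin (2 * n)) ℝ)) *ᵥ Y := by
    intro X Y
    change ((g : Matrix _ _ ℝ) *ᵥ X) ⬝ᵥ Jst n *ᵥ ((g : Matrix _ _ ℝ) *ᵥ Y) = _
    rw [← Matrix.mulVec_mulVec, ← Matrix.mulVec_mulVec, Matrix.dotProduct_mulVec X,
      Matrix.vecMul_transpose]
  constructor
  · intro h
    ext i j
    have := h (Pi.single i 1) (Pi.single j 1)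
    rw [e] at this
    change _ = Pi.single i 1 ⬝ᵥ Jst n *ᵥ Pi.single j 1 at this
    simpa using this
  · intro h X Y
    rw [e, h]
    rfl

theorem Ric_transpose {m : ℕ} (μ : Vm m) : (Ric μ)ᵀ = Ric μ := by
  ext i j
  simp only [Ric, Matrix.transpose_apply, Matrix.of_apply]
  congr 2 <;>
    exact Finset.sum_congr rfl fun _ _ => Finset.sum_congr rfl fun _ _ => mul_comm _ _

theorem Ricac_transpose (μ : Vm (2 * n)) : (Ricac n μ)ᵀ = Ricac n μ := by
  rw [Ricac, Matrix.transpose_smul, Matrix.transpose_add, Matrix.transpose_mul,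
    Matrix.transpose_mul, Ric_transpose, Jst_transpose]
  simp only [neg_mul, mul_neg, neg_neg, mul_assoc]

theorem Ricac_mul_Jst (μ : Vm (2 * n)) : Ricac n μ * Jst n = -(Jst n * Ricac n μ) := by
  simp only [Ricac, smul_mul_assoc, mul_smul_comm, add_mul, mul_add, ← smul_neg]
  congr 1
  rw [mul_assoc _ (Jst n) (Jst n), ← mul_assoc (Jst n) (Jst n * Ric μ), ← mul_assoc (Jst n) (Jst n),
    Jst_mul_self]
  simp only [mul_neg, mul_one, neg_mul, one_mul, neg_add, neg_neg]
  exact add_comm _ _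

theorem trace_Ricac_mul (μ : Vm (2 * n)) {A : Matrix (Fin (2 * n)) (Fin (2 * n)) ℝ}
    (hA : A * Jst n = -(Jst n * A)) :
    Matrix.trace (Ricac n μ * A) = Matrix.trace (Ric μ * A) := by
  have h : Matrix.trace (Jst n * Ric μ * Jst n * A) = Matrix.trace (Ric μ * A) := by
    rw [mul_assoc, mul_assoc, Matrix.trace_mul_comm]
    have : Jst n * A * Jst n = A := by
      rw [mul_assoc, hA, mul_neg, ← mul_assoc, Jst_mul_self, neg_mul, one_mul, neg_neg]
    rw [mul_assoc, this]
  rw [Ricac, smul_mul_assoc, add_mul, Matrix.trace_smul, Matrix.trace_add, h, smul_eq_mul]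
  ring

end Symplectic

/-- uniqueness of minimal compatible metrics in the symplectic case:
if `μ` (nonzero, nilpotent, with `ω` closed) and `g·μ` (for `g ∈ Sp(n,ℝ)`) both satisfy
`Ricac = cI + D` with `D` a derivation, then `g·μ = r (k·μ)` for some `r ≠ 0` and
`k ∈ Sp(n,ℝ) ∩ O(2n)`. -/
theorem symplectic_minimal_unique (n : ℕ) (μ : Vm (2*n))
    (hskew : IsSkewBilin μ) (hjac : Jacobi μ) (hnil : IsNilp μ) (hne : μ ≠ 0)
    (hcl : OmegaClosed n μ)
    (c : ℝ) (D : Matrix (Fin (2*n)) (Fin (2*n)) ℝ)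
    (hRic : Ricac n μ = c • (1 : Matrix (Fin (2*n)) (Fin (2*n)) ℝ) + D) (hD : IsDeriv μ D)
    (g : GL (Fin (2*n)) ℝ) (hg : InSp n g)
    (c' : ℝ) (D' : Matrix (Fin (2*n)) (Fin (2*n)) ℝ)
    (hRic' : Ricac n (act g μ) = c' • (1 : Matrix (Fin (2*n)) (Fin (2*n)) ℝ) + D')
    (hD' : IsDeriv (act g μ) D') :
    ∃ (r : ℝ) (k : GL (Fin (2*n)) ℝ), r ≠ 0 ∧ InSp n k ∧
      ((k : Matrix (Fin (2*n)) (Fin (2*n)) ℝ))ᵀ * (k : Matrix (Fin (2*n)) (Fin (2*n)) ℝ) = 1 ∧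
      act g μ = r • act k μ := by
  have hν : IsSkewBilin (act g μ) := hskew.conjBrk _ _
  have hc : infAct (Ricac n μ) μ = (-c) • μ := by
    rw [hRic]
    exact infAct_smul_one_add hskew c hD
  have hc' : infAct (Ricac n (act g μ)) (act g μ) = (-c') • act g μ := by
    conv_lhs => rw [hRic']
    exact infAct_smul_one_add hν c' hD'
  obtain ⟨k₀, A₀, hp, -⟩ := exists_isPolarPair (μ := μ) (ν := act g μ) Jst_mul_self Jst_transpose
    (h := (g : Matrix (Fin (2 * n)) (Fin (2 * n)) ℝ))
    (h' := ((g⁻¹ : GL (Fin (2 * n)) ℝ) : Matrix (Fin (2 * n)) (Fin (2 * n)) ℝ)) (r := 1)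
    g.mul_inv ((inSp_iff g).1 hg) (by rw [one_smul]; rfl)
  obtain ⟨k, r, hk, hkJ, hr⟩ := exists_unitary_conjBrk_eq_smul Jst_mul_self Jst_transpose hskew hν
    (Ricac_transpose _) (Ricac_mul_Jst _) (Ricac_transpose _) (Ricac_mul_Jst _) hc hc'
    (fun _ => trace_Ricac_mul _) (fun _ => trace_Ricac_mul _) ⟨_, hp⟩
  have hr0 : r ≠ 0 := by
    rintro rfl
    have h := congrArg (conjBrk kᵀ k) hr
    rw [conjBrk_smul, zero_smul, conjBrk_conjBrk, hk, conjBrk_one] at h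
    exact hne h
  have hact : act ⟨k, kᵀ, mul_eq_one_comm.1 hk, hk⟩ μ = r • act g μ := hr
  refine ⟨r⁻¹, ⟨k, kᵀ, mul_eq_one_comm.1 hk, hk⟩, inv_ne_zero hr0, (inSp_iff _).2 hkJ, hk, ?_⟩
  rw [hact, smul_smul, inv_mul_cancel₀ hr0, one_smul]
end

section
/- Let μ_n be the bracket on ℝ^{2n} (2n ≥ 4) with μ_n(e_1,e_2) = e_3 and all other brackets of basis vectors zero. Then the anti-complexified Ricci operator satisfies Ricac_{μ_n} = cI + D for some c ∈ ℝ and some derivation D ∈ Der(μ_n); for example, when 2n = 4 one has Ricac_{μ_2} = −(1/4)diag(1,2,−2,−1) = −(5/4)I + (1/4)diag(4,3,7,6), and diag(4,3,7,6) is a derivation of μ_2. -/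
open scoped BigOperators Matrix

/-- The bracket `μ_n` on `ℝ^{2n}` with `μ_n(e_1,e_2) = e_3` (and all other brackets of
basis vectors zero), i.e. `μ_n ≃ h_3 ⊕ ℝ^{2n-3}`. -/
noncomputable def muHeis (n : ℕ) (hn : 2 ≤ n) : Vm (2*n) :=
  fun X Y =>
    (X ⟨0, by omega⟩ * Y ⟨1, by omega⟩ - X ⟨1, by omega⟩ * Y ⟨0, by omega⟩) •
      stdb (2*n) ⟨2, by omega⟩

/-- The structure constants of `muHeis`: all brackets of basis vectors lie in the span of `e_3`. -/
lemma muHeis_stdb (n : ℕ) (hn : 2 ≤ n) (x i j : Fin (2*n)) :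
    muHeis n hn (stdb (2*n) x) (stdb (2*n) i) j =
      ((if x = ⟨0, by omega⟩ then 1 else 0) * (if i = ⟨1, by omega⟩ then 1 else 0) -
        (if x = ⟨1, by omega⟩ then 1 else 0) * (if i = ⟨0, by omega⟩ then 1 else 0)) *
      (if j = ⟨2, by omega⟩ then 1 else 0) := by
  simp only [muHeis, stdb, Pi.smul_apply, smul_eq_mul, Pi.single_apply, @eq_comm _ _ x,
    @eq_comm _ _ i]

lemma Ric_muHeis (n : ℕ) (hn : 2 ≤ n) :
    Ric (muHeis n hn) = Matrix.diagonal (fun x : Fin (2*n) =>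
      if (x : ℕ) = 0 ∨ (x : ℕ) = 1 then (-(1/2) : ℝ) else if (x : ℕ) = 2 then 1/2 else 0) := by
  ext x y
  have h01 : (⟨0, by omega⟩ : Fin (2*n)) ≠ ⟨1, by omega⟩ := by simp
  simp only [Ric, Matrix.of_apply, muHeis_stdb, Matrix.diagonal_apply]
  simp only [mul_mul_mul_comm _ (ite _ _ _), ← Finset.mul_sum, ← Finset.sum_mul]
  simp only [mul_sub, Finset.sum_sub_distrib, mul_ite, mul_one, mul_zero,
    Finset.sum_ite_eq', Finset.mem_univ, if_true, h01, h01.symm, if_false]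
  simp only [Fin.ext_iff]
  split_ifs <;> first | omega | norm_num

lemma Jst_apply (n : ℕ) (x y : Fin (2*n)) :
    Jst n x y = if y = x.rev then (if (y : ℕ) < n then 1 else -1) else 0 := by
  have h : (x : ℕ) + (y : ℕ) = 2*n - 1 ↔ y = x.rev := by
    rw [Fin.ext_iff, Fin.val_rev]; omega
  simp only [Jst, Matrix.of_apply, h]

/-- Since `J² = -1`, conjugating a diagonal matrix by `J` reverses its entries. -/
lemma Jst_mul_diagonal_mul_Jst (n : ℕ) (d : Fin (2*n) → ℝ) :
    Jst n * Matrix.diagonal d * Jst n = Matrix.diagonal (fun x => -d x.rev) := by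
  ext x y
  rw [Matrix.mul_apply]
  simp only [Matrix.mul_diagonal, Jst_apply, Matrix.diagonal_apply, ite_mul, zero_mul,
    Finset.sum_ite_eq', Finset.mem_univ, if_true, Fin.rev_rev]
  by_cases h : y = x
  · subst h
    simp only [Fin.val_rev, if_true]
    split_ifs <;> first | omega | ring
  · simp [h, Ne.symm h]

lemma Ricac_muHeis (n : ℕ) (hn : 2 ≤ n) :
    ∃ d : Fin (2*n) → ℝ, Ricac n (muHeis n hn) = Matrix.diagonal d ∧
      ∀ x, d x = (1/2) * ((if (x : ℕ) = 0 ∨ (x : ℕ) = 1 then (-(1/2) : ℝ) else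
          if (x : ℕ) = 2 then 1/2 else 0) -
        (if (x.rev : ℕ) = 0 ∨ (x.rev : ℕ) = 1 then (-(1/2) : ℝ) else
          if (x.rev : ℕ) = 2 then 1/2 else 0)) := by
  refine ⟨_, ?_, fun x => rfl⟩
  rw [Ricac, Ric_muHeis, Jst_mul_diagonal_mul_Jst, Matrix.diagonal_add, ← Matrix.diagonal_smul]
  rfl

lemma isDeriv_muHeis_diagonal (n : ℕ) (hn : 2 ≤ n) (d : Fin (2*n) → ℝ)
    (hd : d ⟨2, by omega⟩ = d ⟨0, by omega⟩ + d ⟨1, by omega⟩) :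
    IsDeriv (muHeis n hn) (Matrix.diagonal d) := by
  intro X Y
  ext k
  simp only [muHeis, Matrix.mulVec_diagonal, Pi.add_apply, Pi.smul_apply, smul_eq_mul, stdb,
    Pi.single_apply]
  split_ifs with h
  · subst h
    rw [hd]
    ring
  · simp

/-- `Ricac_{μ_n} = cI + D` with `D` a derivation; in the case `2n = 4`,
explicitly `Ricac_{μ_2} = -(1/4)diag(1,2,-2,-1) = -(5/4)I + (1/4)diag(4,3,7,6)`,
and `diag(4,3,7,6)` is a derivation of `μ_2`. -/
theorem Ricac_muHeis_minimal (n : ℕ) (hn : 2 ≤ n) :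
    (∃ (c : ℝ) (D : Matrix (Fin (2*n)) (Fin (2*n)) ℝ),
        Ricac n (muHeis n hn) = c • (1 : Matrix (Fin (2*n)) (Fin (2*n)) ℝ) + D ∧
        IsDeriv (muHeis n hn) D) ∧
    (Ricac 2 (muHeis 2 le_rfl) =
        (-(1/4) : ℝ) • Matrix.diagonal (fun i : Fin (2*2) =>
          if (i : ℕ) = 0 then (1:ℝ) else if (i : ℕ) = 1 then 2 else
            if (i : ℕ) = 2 then -2 else -1) ∧
      Ricac 2 (muHeis 2 le_rfl) =
        (-(5/4) : ℝ) • (1 : Matrix (Fin (2*2)) (Fin (2*2)) ℝ) +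
          (1/4 : ℝ) • Matrix.diagonal (fun i : Fin (2*2) =>
            if (i : ℕ) = 0 then (4:ℝ) else if (i : ℕ) = 1 then 3 else
              if (i : ℕ) = 2 then 7 else 6) ∧
      IsDeriv (muHeis 2 le_rfl) (Matrix.diagonal (fun i : Fin (2*2) =>
        if (i : ℕ) = 0 then (4:ℝ) else if (i : ℕ) = 1 then 3 else
          if (i : ℕ) = 2 then 7 else 6))) := by
  refine ⟨?_, ?_⟩
  · obtain ⟨d, hR, -⟩ := Ricac_muHeis n hn
    let c := d ⟨0, by omega⟩ + d ⟨1, by omega⟩ - d ⟨2, by omega⟩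
    refine ⟨c, Matrix.diagonal (fun x => d x - c), ?_, ?_⟩
    · rw [hR, Matrix.smul_one_eq_diagonal, Matrix.diagonal_add]
      simp
    · apply isDeriv_muHeis_diagonal
      simp only [c]
      ring
  · obtain ⟨d, hR, hd⟩ := Ricac_muHeis 2 le_rfl
    refine ⟨?_, ?_, ?_⟩
    · rw [hR, ← Matrix.diagonal_smul]
      congr 1
      ext x
      rw [hd]
      fin_cases x <;> norm_num [Fin.val_rev]
    · rw [hR, Matrix.smul_one_eq_diagonal, ← Matrix.diagonal_smul, Matrix.diagonal_add]
      congr 1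
      ext x
      rw [hd]
      fin_cases x <;> norm_num [Fin.val_rev]
    · apply isDeriv_muHeis_diagonal
      norm_num
end

section
/- Let λ be the bracket on ℝ⁴ with λ(e_1,e_2) = e_3, λ(e_1,e_3) = e_4, and all other brackets of basis vectors zero. Then the diagonal operator diag(1,2,3,4) is a derivation of λ, and the anti-complexified Ricci operator satisfies Ricac_λ = −(1/4)diag(3,1,−1,−3) = −(5/4)I + (1/2)diag(1,2,3,4) ∈ ℝI + Der(λ). -/
open scoped BigOperators Matrix

/-- The complex structure `J` on `ℝ⁴`: `Je_1 = e_4, Je_2 = e_3, Je_3 = -e_2, Je_4 = -e_1`. -/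
noncomputable def J4 : Matrix (Fin 4) (Fin 4) ℝ :=
  !![0, 0, 0, -1;
     0, 0, -1, 0;
     0, 1, 0, 0;
     1, 0, 0, 0]

/-- The anti-complexified Ricci operator on `ℝ⁴`. -/
noncomputable def Ricac4 (μ : Vm 4) : Matrix (Fin 4) (Fin 4) ℝ :=
  (1/2 : ℝ) • (Ric μ + J4 * Ric μ * J4)

/-- The bracket `λ` on `ℝ⁴` with `λ(e_1,e_2) = e_3`, `λ(e_1,e_3) = e_4`. -/
noncomputable def lam4 : Vm 4 :=
  fun X Y => (X 0 * Y 1 - X 1 * Y 0) • stdb 4 2 + (X 0 * Y 2 - X 2 * Y 0) • stdb 4 3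

/-- A diagonal operator is a derivation of `λ` as soon as its entries satisfy the weight relations
`d₃ = d₁ + d₂` and `d₄ = d₁ + d₃`. -/
theorem isDeriv_lam4_diagonal {d : Fin 4 → ℝ} (h2 : d 2 = d 0 + d 1) (h3 : d 3 = d 0 + d 2) :
    IsDeriv lam4 (Matrix.diagonal d) := by
  intro X Y
  ext i
  fin_cases i <;> simp [Matrix.mulVec_diagonal, lam4, stdb, h2, h3] <;> ring

theorem Ric_lam4 : Ric lam4 = Matrix.diagonal ![-1, -(1/2), 0, 1/2] := by
  ext i j
  fin_cases i <;> fin_cases j <;>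
    simp [Ric, lam4, stdb, Fin.sum_univ_four, Pi.single_apply] <;> norm_num

theorem Ricac4_lam4 :
    Ricac4 lam4 = (-(1/4) : ℝ) • Matrix.diagonal (![3, 1, -1, -3] : Fin 4 → ℝ) := by
  rw [Ricac4, Ric_lam4]
  ext i j
  simp only [Matrix.smul_apply, Matrix.add_apply, Matrix.mul_apply, Fin.sum_univ_four]
  fin_cases i <;> fin_cases j <;> simp [J4] <;> norm_num

/-- `diag(1,2,3,4)` is a derivation of `λ` and
`Ricac_λ = -(1/4)diag(3,1,-1,-3) = -(5/4)I + (1/2)diag(1,2,3,4) ∈ ℝI + Der(λ)`. -/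
theorem Ricac_lam4 :
    IsDeriv lam4 (Matrix.diagonal (![1, 2, 3, 4] : Fin 4 → ℝ)) ∧
    Ricac4 lam4 = (-(1/4) : ℝ) • Matrix.diagonal (![3, 1, -1, -3] : Fin 4 → ℝ) ∧
    Ricac4 lam4 = (-(5/4) : ℝ) • (1 : Matrix (Fin 4) (Fin 4) ℝ) +
      (1/2 : ℝ) • Matrix.diagonal (![1, 2, 3, 4] : Fin 4 → ℝ) ∧
    (∃ (c : ℝ) (D : Matrix (Fin 4) (Fin 4) ℝ),
      Ricac4 lam4 = c • (1 : Matrix (Fin 4) (Fin 4) ℝ) + D ∧ IsDeriv lam4 D) := by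
  have hD : Ricac4 lam4 = (-(5/4) : ℝ) • (1 : Matrix (Fin 4) (Fin 4) ℝ) +
      (1/2 : ℝ) • Matrix.diagonal (![1, 2, 3, 4] : Fin 4 → ℝ) := by
    rw [Ricac4_lam4, ← Matrix.diagonal_one, ← Matrix.diagonal_smul, ← Matrix.diagonal_smul,
      ← Matrix.diagonal_smul, Matrix.diagonal_add]
    congr 1
    ext i
    fin_cases i <;> norm_num
  refine ⟨isDeriv_lam4_diagonal ?_ ?_, Ricac4_lam4, hD, _, _, hD, ?_⟩
  · simp; norm_num
  · simp; norm_num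
  · rw [← Matrix.diagonal_smul]
    apply isDeriv_lam4_diagonal <;> simp <;> norm_num
end

section
/- Let μ(a,b,c) be the bracket on ℝ⁶ with μ(e_1,e_2) = a e_4, μ(e_1,e_3) = b e_5, μ(e_2,e_3) = c e_6, and all other brackets of basis vectors zero. Then the 2-form ω is closed for μ(a,b,c) if and only if a − b + c = 0. -/
open scoped BigOperators Matrix

/-- The almost-complex structure `J` on `ℝ⁶`:
`Je_1 = e_6, Je_2 = e_5, Je_3 = e_4, Je_4 = -e_3, Je_5 = -e_2, Je_6 = -e_1`. -/
noncomputable def J6 : Matrix (Fin 6) (Fin 6) ℝ :=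
  !![0, 0, 0, 0, 0, -1;
     0, 0, 0, 0, -1, 0;
     0, 0, 0, -1, 0, 0;
     0, 0, 1, 0, 0, 0;
     0, 1, 0, 0, 0, 0;
     1, 0, 0, 0, 0, 0]

/-- The symplectic form `ω(X,Y) = ⟨X, JY⟩` on `ℝ⁶`. -/
noncomputable def omega6 (X Y : Fin 6 → ℝ) : ℝ := ∑ i, X i * J6.mulVec Y i

/-- The two-step nilpotent bracket `μ(a,b,c)` on `ℝ⁶`:
`μ(e_1,e_2) = a e_4`, `μ(e_1,e_3) = b e_5`, `μ(e_2,e_3) = c e_6`. -/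
noncomputable def mu6 (a b c : ℝ) : Vm 6 :=
  fun X Y =>
    ((X 0 * Y 1 - X 1 * Y 0) * a) • stdb 6 3 +
    ((X 0 * Y 2 - X 2 * Y 0) * b) • stdb 6 4 +
    ((X 1 * Y 2 - X 2 * Y 1) * c) • stdb 6 5

/-- `ω(μ(a,b,c)(X,Y), Z)` in coordinates. -/
theorem omega6_mu6 (a b c : ℝ) (X Y Z : Fin 6 → ℝ) :
    omega6 (mu6 a b c X Y) Z =
      (X 0 * Y 1 - X 1 * Y 0) * a * Z 2 + (X 0 * Y 2 - X 2 * Y 0) * b * Z 1 +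
        (X 1 * Y 2 - X 2 * Y 1) * c * Z 0 := by
  simp [omega6, mu6, stdb, J6, Matrix.mulVec, dotProduct, Fin.sum_univ_six, Pi.single_apply]

/-- `ω` is closed for `μ(a,b,c)` iff `a - b + c = 0`. -/
theorem omega_closed_mu6_iff (a b c : ℝ) :
    (∀ X Y Z : Fin 6 → ℝ,
        omega6 (mu6 a b c X Y) Z + omega6 (mu6 a b c Y Z) X + omega6 (mu6 a b c Z X) Y = 0)
      ↔ a - b + c = 0 := by
  simp only [omega6_mu6]
  constructor
  · intro h
    have h₁ := h (Pi.single 0 1) (Pi.single 1 1) (Pi.single 2 1)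
    simp at h₁
    linarith
  · intro h X Y Z
    linear_combination
      (X 0 * (Y 1 * Z 2 - Y 2 * Z 1) - X 1 * (Y 0 * Z 2 - Y 2 * Z 0) +
        X 2 * (Y 0 * Z 1 - Y 1 * Z 0)) * h
end

section
/- Let μ = μ(a,b,c) be the bracket on ℝ⁶ with μ(e_1,e_2) = a e_4, μ(e_1,e_3) = b e_5, μ(e_2,e_3) = c e_6, and all other brackets of basis vectors zero. Then the anti-complexified Ricci operator equals Ricac_μ = −(1/4)(a²+b²+c²) diag(1,1,1,−1,−1,−1) = −(3/4)(a²+b²+c²) I + (1/2)(a²+b²+c²) diag(1,1,1,2,2,2), and diag(1,1,1,2,2,2) is a derivation of μ; in particular Ricac_μ ∈ ℝI + Der(μ). -/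
open scoped BigOperators Matrix

/-- The anti-complexified Ricci operator on `ℝ⁶`. -/
noncomputable def Ricac6 (μ : Vm 6) : Matrix (Fin 6) (Fin 6) ℝ :=
  (1/2 : ℝ) • (Ric μ + J6 * Ric μ * J6)

theorem mu6_eq (a b c : ℝ) (X Y : Fin 6 → ℝ) :
    mu6 a b c X Y =
      ![0, 0, 0, (X 0 * Y 1 - X 1 * Y 0) * a, (X 0 * Y 2 - X 2 * Y 0) * b,
        (X 1 * Y 2 - X 2 * Y 1) * c] := by
  ext i
  fin_cases i <;> simp [mu6, stdb]

theorem Ric_mu6 (a b c : ℝ) :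
    Ric (mu6 a b c) = Matrix.diagonal
      ![-(1/2) * (a^2 + b^2), -(1/2) * (a^2 + c^2), -(1/2) * (b^2 + c^2),
        (1/2) * a^2, (1/2) * b^2, (1/2) * c^2] := by
  ext x y
  fin_cases x <;> fin_cases y <;>
    simp [Ric, mu6_eq, stdb, Fin.sum_univ_six, Pi.single_apply] <;> ring

theorem J6_mul_diagonal_mul_J6 (d : Fin 6 → ℝ) :
    J6 * Matrix.diagonal d * J6 = Matrix.diagonal fun i => -d i.rev := by
  ext x y
  rw [Matrix.mul_apply]
  fin_cases x <;> fin_cases y <;>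
    simp [J6, Fin.sum_univ_six, Matrix.mul_diagonal, Fin.rev]

theorem isDeriv_mu6_smul_diagonal (a b c t : ℝ) :
    IsDeriv (mu6 a b c) (t • Matrix.diagonal (![1, 1, 1, 2, 2, 2] : Fin 6 → ℝ)) := by
  intro X Y
  ext i
  simp only [mu6_eq, Matrix.smul_mulVec, Matrix.mulVec_diagonal, Pi.smul_apply, Pi.add_apply,
    smul_eq_mul]
  fin_cases i <;> simp <;> ring

theorem Ricac6_mu6_eq_smul_diagonal (a b c : ℝ) :
    Ricac6 (mu6 a b c) =
      (-(1/4) * (a^2 + b^2 + c^2)) •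
        Matrix.diagonal (![1, 1, 1, -1, -1, -1] : Fin 6 → ℝ) := by
  rw [Ricac6, Ric_mu6, J6_mul_diagonal_mul_J6, Matrix.diagonal_add, ← Matrix.diagonal_smul,
    ← Matrix.diagonal_smul]
  congr 1
  ext i
  fin_cases i <;> simp [Fin.rev] <;> ring

theorem smul_diagonal_eq_smul_one_add (s : ℝ) :
    (-(1/4) * s) • Matrix.diagonal (![1, 1, 1, -1, -1, -1] : Fin 6 → ℝ) =
      (-(3/4) * s) • (1 : Matrix (Fin 6) (Fin 6) ℝ) +
        ((1/2) * s) • Matrix.diagonal (![1, 1, 1, 2, 2, 2] : Fin 6 → ℝ) := by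
  rw [← Matrix.diagonal_one, ← Matrix.diagonal_smul, ← Matrix.diagonal_smul,
    ← Matrix.diagonal_smul, Matrix.diagonal_add]
  congr 1
  ext i
  fin_cases i <;> simp <;> ring

/-- `Ricac_{μ(a,b,c)} = -(1/4)(a²+b²+c²)diag(1,1,1,-1,-1,-1)
= -(3/4)(a²+b²+c²)I + (1/2)(a²+b²+c²)diag(1,1,1,2,2,2)`, and `diag(1,1,1,2,2,2)` is a
derivation of `μ(a,b,c)`; in particular `Ricac ∈ ℝI + Der(μ)`. -/
theorem Ricac_mu6 (a b c : ℝ) :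
    Ricac6 (mu6 a b c) =
      (-(1/4) * (a^2 + b^2 + c^2)) • Matrix.diagonal (![1, 1, 1, -1, -1, -1] : Fin 6 → ℝ) ∧
    Ricac6 (mu6 a b c) =
      (-(3/4) * (a^2 + b^2 + c^2)) • (1 : Matrix (Fin 6) (Fin 6) ℝ) +
        ((1/2) * (a^2 + b^2 + c^2)) • Matrix.diagonal (![1, 1, 1, 2, 2, 2] : Fin 6 → ℝ) ∧
    IsDeriv (mu6 a b c) (Matrix.diagonal (![1, 1, 1, 2, 2, 2] : Fin 6 → ℝ)) ∧
    (∃ (r : ℝ) (D : Matrix (Fin 6) (Fin 6) ℝ),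
      Ricac6 (mu6 a b c) = r • (1 : Matrix (Fin 6) (Fin 6) ℝ) + D ∧ IsDeriv (mu6 a b c) D) := by
  have h := Ricac6_mu6_eq_smul_diagonal a b c
  have h' := h.trans (smul_diagonal_eq_smul_one_add _)
  refine ⟨h, h', ?_, _, _, h', isDeriv_mu6_smul_diagonal a b c _⟩
  simpa using isDeriv_mu6_smul_diagonal a b c 1
end

section
/- For s,t ≥ 0 with s² + st + t² = 1 and 0 ≤ t ≤ 1/√3, let μ_{st} = μ(s, s+t, t) be the bracket on ℝ⁶ with μ(e_1,e_2) = s e_4, μ(e_1,e_3) = (s+t) e_5, μ(e_2,e_3) = t e_6 (all other brackets of basis vectors zero). Then for distinct parameters (s,t) ≠ (s′,t′) in this range, there is no orthogonal linear map φ ∈ O(6) with φ(μ_{st}(X,Y)) = μ_{s′t′}(φX, φY) for all X,Y; that is, the metric nilpotent Lie algebras (ℝ⁶, μ_{st}, ⟨·,·⟩) are pairwise non-isometric. -/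
open scoped BigOperators Matrix

/-- The skew-symmetric matrix of the bilinear form `(X, Y) ↦ ⟨μ(a,b,c)(X, Y), e_x⟩`. -/
noncomputable def structMatrix (a b c : ℝ) (x : Fin 6) : Matrix (Fin 6) (Fin 6) ℝ :=
  Matrix.of fun i j => mu6 a b c (stdb 6 i) (stdb 6 j) x

lemma mu6_eq_dotProduct (a b c : ℝ) (X Y : Fin 6 → ℝ) (x : Fin 6) :
    mu6 a b c X Y x = X ⬝ᵥ (structMatrix a b c x *ᵥ Y) := by
  fin_cases x <;>
    simp [mu6, stdb, structMatrix, dotProduct, Matrix.mulVec, Fin.sum_univ_six, Pi.single_apply] <;>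
    ring

lemma trace_structMatrix_mul (a b c : ℝ) :
    (Matrix.of fun x y => ((structMatrix a b c x)ᵀ * structMatrix a b c y).trace) =
      Matrix.diagonal ![0, 0, 0, 2 * a ^ 2, 2 * b ^ 2, 2 * c ^ 2] := by
  ext x y
  fin_cases x <;> fin_cases y <;>
    simp [mu6, stdb, structMatrix, Matrix.trace, Matrix.mul_apply, Fin.sum_univ_six,
      Pi.single_apply] <;>
    ring

/-- The Gram matrices of two families of square matrices related by an orthogonal change of
coordinates are conjugate. -/
lemma gram_conj {n : ℕ} {M N : Fin n → Matrix (Fin n) (Fin n) ℝ} {φ : Matrix (Fin n) (Fin n) ℝ}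
    (hφ : φᵀ * φ = 1) (h : ∀ y, ∑ x, φ y x • M x = φᵀ * N y * φ) :
    φ * (Matrix.of fun x y => ((M x)ᵀ * M y).trace) * φᵀ =
      Matrix.of fun x y => ((N x)ᵀ * N y).trace := by
  have hφ' : φ * φᵀ = 1 := mul_eq_one_comm.mp hφ
  ext y z
  have key : ((∑ x, φ y x • M x)ᵀ * ∑ x, φ z x • M x).trace = ((N y)ᵀ * N z).trace := by
    rw [h, h]
    calc ((φᵀ * N y * φ)ᵀ * (φᵀ * N z * φ)).trace
        = (φᵀ * ((N y)ᵀ * (φ * φᵀ) * N z * φ)).trace := by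
          simp only [Matrix.transpose_mul, Matrix.transpose_transpose, Matrix.mul_assoc]
      _ = ((N y)ᵀ * N z * (φ * φᵀ)).trace := by
          rw [Matrix.trace_mul_comm, hφ', mul_one, Matrix.mul_assoc, hφ']
      _ = ((N y)ᵀ * N z).trace := by rw [hφ', mul_one]
  rw [Matrix.of_apply, ← key]
  simp only [Matrix.mul_apply (M := φ * _), Matrix.mul_apply (M := φ), Matrix.transpose_sum,
    Matrix.transpose_smul, Matrix.mul_sum, Matrix.trace_sum, Matrix.smul_mul,
    Matrix.mul_smul, Matrix.trace_smul, smul_eq_mul, Matrix.of_apply, Matrix.transpose_apply,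
    Finset.sum_mul]
  rw [Finset.sum_comm]
  refine Finset.sum_congr rfl fun _ _ => Finset.sum_congr rfl fun _ _ => by ring

lemma trace_pow_conj {n : ℕ} {φ A B : Matrix (Fin n) (Fin n) ℝ}
    (hφ : φᵀ * φ = 1) (h : φ * A * φᵀ = B) (k : ℕ) : (B ^ k).trace = (A ^ k).trace := by
  have hk : B ^ k = φ * A ^ k * φᵀ := by
    induction k with
    | zero => simpa using (mul_eq_one_comm.mp hφ).symm
    | succ k ih =>
      calc B ^ (k + 1) = φ * A ^ k * (φᵀ * φ) * A * φᵀ := by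
            rw [pow_succ, ih, ← h]; simp only [mul_assoc]
        _ = _ := by rw [hφ, mul_one, pow_succ]; simp only [mul_assoc]
  rw [hk, Matrix.trace_mul_comm, ← mul_assoc, hφ, one_mul]

lemma mu6_sum_pow_six_eq {a b c a' b' c' : ℝ} {φ : Matrix (Fin 6) (Fin 6) ℝ} (hφ : φᵀ * φ = 1)
    (h : ∀ X Y : Fin 6 → ℝ,
      φ.mulVec (mu6 a b c X Y) = mu6 a' b' c' (φ.mulVec X) (φ.mulVec Y)) :
    a' ^ 6 + b' ^ 6 + c' ^ 6 = a ^ 6 + b ^ 6 + c ^ 6 := by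
  have hM : ∀ y, ∑ x, φ y x • structMatrix a b c x = φᵀ * structMatrix a' b' c' y * φ := by
    intro y
    ext i j
    have hij := congrFun (h (stdb 6 i) (stdb 6 j)) y
    rw [mu6_eq_dotProduct] at hij
    simp only [stdb, Matrix.mulVec_single_one] at hij
    rw [mul_assoc, Matrix.sum_apply, Matrix.mul_apply]
    simpa [Matrix.mulVec, dotProduct, structMatrix, stdb, Matrix.mul_apply, Matrix.col] using hij
  have ht := trace_pow_conj hφ (gram_conj hφ hM) 3
  rw [trace_structMatrix_mul, trace_structMatrix_mul, Matrix.diagonal_pow, Matrix.diagonal_pow]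
    at ht
  simp [Matrix.trace, Fin.sum_univ_six] at ht
  linarith

lemma le_of_le_one_div_sqrt_three {s t : ℝ} (hs : 0 ≤ s) (ht : 0 ≤ t)
    (h1 : s ^ 2 + s * t + t ^ 2 = 1) (ht3 : t ≤ 1 / Real.sqrt 3) : t ≤ s := by
  have hsq : t ^ 2 ≤ 1 / 3 := by
    calc t ^ 2 ≤ (1 / Real.sqrt 3) ^ 2 := by gcongr
      _ = 1 / 3 := by rw [div_pow, Real.sq_sqrt (by norm_num)]; norm_num
  by_contra! hlt
  nlinarith

/-- the metric nilpotent Lie algebras `(ℝ⁶, μ(s,s+t,t), ⟨·,·⟩)`, for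
`s,t ≥ 0`, `s² + st + t² = 1`, `0 ≤ t ≤ 1/√3`, are pairwise non-isometric: for distinct
parameters there is no orthogonal `φ` with `φ(μ_{st}(X,Y)) = μ_{s't'}(φX, φY)`. -/
theorem mu6_curve_pairwise_nonisometric (s t s' t' : ℝ)
    (hs : 0 ≤ s) (ht : 0 ≤ t) (h1 : s^2 + s*t + t^2 = 1) (ht3 : t ≤ 1 / Real.sqrt 3)
    (hs' : 0 ≤ s') (ht' : 0 ≤ t') (h1' : s'^2 + s'*t' + t'^2 = 1)
    (ht3' : t' ≤ 1 / Real.sqrt 3) (hne : (s, t) ≠ (s', t')) :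
    ¬ ∃ φ : Matrix (Fin 6) (Fin 6) ℝ, φᵀ * φ = 1 ∧
        ∀ X Y : Fin 6 → ℝ,
          φ.mulVec (mu6 s (s+t) t X Y) = mu6 s' (s'+t') t' (φ.mulVec X) (φ.mulVec Y) := by
  rintro ⟨φ, hφ, h⟩
  apply hne
  have hle := le_of_le_one_div_sqrt_three hs ht h1 ht3
  have hle' := le_of_le_one_div_sqrt_three hs' ht' h1' ht3'
  have sum_six : ∀ u v : ℝ, u ^ 2 + u * v + v ^ 2 = 1 →
      u ^ 6 + (u + v) ^ 6 + v ^ 6 = 2 + 3 * ((u * v) ^ 3 + (u * v) ^ 2) := by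
    intro u v huv
    have : u ^ 6 + (u + v) ^ 6 + v ^ 6 = 2 * (u ^ 2 + u * v + v ^ 2) ^ 3 +
        3 * ((u * v) ^ 3 + (u * v) ^ 2 * (u ^ 2 + u * v + v ^ 2)) := by ring
    rw [this, huv]; ring
  have h6 := mu6_sum_pow_six_eq hφ h
  rw [sum_six s t h1, sum_six s' t' h1'] at h6
  have mono : ∀ p q : ℝ, 0 ≤ p → p < q → p ^ 3 + p ^ 2 < q ^ 3 + q ^ 2 := by
    intro p q hp hpq
    gcongr
  have hprod : s * t = s' * t' := by
    rcases lt_trichotomy (s * t) (s' * t') with hlt | heq | hlt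
    · linarith [mono _ _ (mul_nonneg hs ht) hlt]
    · exact heq
    · linarith [mono _ _ (mul_nonneg hs' ht') hlt]
  have hsum : s + t = s' + t' := by
    rw [← sq_eq_sq₀ (by positivity) (by positivity)]
    linarith [add_sq s t, add_sq s' t']
  have hdiff : s - t = s' - t' := by
    rw [← sq_eq_sq₀ (by linarith) (by linarith)]
    linarith [sub_sq s t, sub_sq s' t']
  exact Prod.ext (by dsimp only; linarith) (by dsimp only; linarith)
end

section
/- Let W be the space of skew-symmetric bilinear maps μ : n₁ × n₁ → n₂ where n₁ = span(X_1,…,X_4) and n₂ = span(Z_1,Z_2), each μ determined by its coefficient pairs A,B,C,D,E,F ∈ ℝ² via μ(X_1,X_2) = a_1Z_1 + a_2Z_2, μ(X_1,X_3) = b_1Z_1 + b_2Z_2, μ(X_1,X_4) = c_1Z_1 + c_2Z_2, μ(X_2,X_3) = d_1Z_1 + d_2Z_2, μ(X_2,X_4) = e_1Z_1 + e_2Z_2, μ(X_3,X_4) = f_1Z_1 + f_2Z_2. Then: (1) J is integrable on (ℝ⁶, μ), i.e. μ(JX,JY) = μ(X,Y) + Jμ(JX,Y) + Jμ(X,JY)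 for all X,Y, if and only if E = B + JD + JC; (2) J is abelian, i.e. μ(JX,JY) = μ(X,Y) for all X,Y, if and only if E = B and D = −C; (3) J is bi-invariant, i.e. μ(JX,Y) = Jμ(X,Y) for all X,Y, if and only if A = F = 0, C = D = JB, and E = −B. Here J acts on coefficient vectors (p,q) ∈ ℝ² by J(p,q) = (−q,p). -/
open scoped BigOperators Matrix

/-- The complex structure `J` on `ℝ⁶ = n₁ ⊕ n₂` (basis `X_1,…,X_4,Z_1,Z_2`):
`JX_1 = X_2, JX_2 = -X_1, JX_3 = X_4, JX_4 = -X_3, JZ_1 = Z_2, JZ_2 = -Z_1`. -/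
noncomputable def Jc : Matrix (Fin 6) (Fin 6) ℝ :=
  !![0, -1, 0, 0, 0, 0;
     1, 0, 0, 0, 0, 0;
     0, 0, 0, -1, 0, 0;
     0, 0, 1, 0, 0, 0;
     0, 0, 0, 0, 0, -1;
     0, 0, 0, 0, 1, 0]

/-- `J` acting on coefficient pairs: `J(p,q) = (-q,p)`. -/
def Jpair (p : ℝ × ℝ) : ℝ × ℝ := (-p.2, p.1)

/-- The vector `p₁ Z_1 + p₂ Z_2 ∈ n₂ ⊆ ℝ⁶`. -/
noncomputable def zvec (p : ℝ × ℝ) : Fin 6 → ℝ := p.1 • stdb 6 4 + p.2 • stdb 6 5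

/-- The element of `W = Λ²n₁* ⊗ n₂` (extended to a 2-step nilpotent bracket on
`ℝ⁶ = n₁ ⊕ n₂` with `n₂` central) with coefficient pairs `A,B,C,D,E,F`:
`μ(X_1,X_2) = a₁Z_1 + a₂Z_2`, `μ(X_1,X_3) = b₁Z_1 + b₂Z_2`, `μ(X_1,X_4) = c₁Z_1 + c₂Z_2`,
`μ(X_2,X_3) = d₁Z_1 + d₂Z_2`, `μ(X_2,X_4) = e₁Z_1 + e₂Z_2`, `μ(X_3,X_4) = f₁Z_1 + f₂Z_2`. -/
noncomputable def muW (A B C D E F : ℝ × ℝ) : Vm 6 :=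
  fun X Y =>
    (X 0 * Y 1 - X 1 * Y 0) • zvec A +
    (X 0 * Y 2 - X 2 * Y 0) • zvec B +
    (X 0 * Y 3 - X 3 * Y 0) • zvec C +
    (X 1 * Y 2 - X 2 * Y 1) • zvec D +
    (X 1 * Y 3 - X 3 * Y 1) • zvec E +
    (X 2 * Y 3 - X 3 * Y 2) • zvec F

theorem Jc_mulVec (X : Fin 6 → ℝ) :
    Jc.mulVec X = ![-X 1, X 0, -X 3, X 2, -X 5, X 4] := by
  ext i
  fin_cases i <;> simp [Jc, Matrix.mulVec, dotProduct, Fin.sum_univ_six]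

theorem muW_apply (A B C D E F : ℝ × ℝ) (X Y : Fin 6 → ℝ) :
    muW A B C D E F X Y = ![0, 0, 0, 0,
      (X 0 * Y 1 - X 1 * Y 0) * A.1 + (X 0 * Y 2 - X 2 * Y 0) * B.1 +
      (X 0 * Y 3 - X 3 * Y 0) * C.1 + (X 1 * Y 2 - X 2 * Y 1) * D.1 +
      (X 1 * Y 3 - X 3 * Y 1) * E.1 + (X 2 * Y 3 - X 3 * Y 2) * F.1,
      (X 0 * Y 1 - X 1 * Y 0) * A.2 + (X 0 * Y 2 - X 2 * Y 0) * B.2 +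
      (X 0 * Y 3 - X 3 * Y 0) * C.2 + (X 1 * Y 2 - X 2 * Y 1) * D.2 +
      (X 1 * Y 3 - X 3 * Y 1) * E.2 + (X 2 * Y 3 - X 3 * Y 2) * F.2] := by
  ext i
  fin_cases i <;> simp [muW, zvec, stdb]

/-- for `μ ∈ W` with coefficient pairs `A,…,F`:
(1) `J` is integrable iff `E = B + JD + JC`;
(2) `J` is abelian iff `E = B` and `D = -C`;
(3) `J` is bi-invariant iff `A = F = 0`, `C = D = JB` and `E = -B`. -/
theorem muW_J_conditions (A B C D E F : ℝ × ℝ) :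
    ((∀ X Y : Fin 6 → ℝ,
        muW A B C D E F (Jc.mulVec X) (Jc.mulVec Y) =
          muW A B C D E F X Y + Jc.mulVec (muW A B C D E F (Jc.mulVec X) Y) +
            Jc.mulVec (muW A B C D E F X (Jc.mulVec Y))) ↔
      E = B + Jpair D + Jpair C) ∧
    ((∀ X Y : Fin 6 → ℝ,
        muW A B C D E F (Jc.mulVec X) (Jc.mulVec Y) = muW A B C D E F X Y) ↔
      (E = B ∧ D = -C)) ∧
    ((∀ X Y : Fin 6 → ℝ,
        muW A B C D E F (Jc.mulVec X) Y = Jc.mulVec (muW A B C D E F X Y)) ↔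
      (A = 0 ∧ F = 0 ∧ C = Jpair B ∧ D = Jpair B ∧ E = -B)) := by
  obtain ⟨a₁, a₂⟩ := A
  obtain ⟨b₁, b₂⟩ := B
  obtain ⟨c₁, c₂⟩ := C
  obtain ⟨d₁, d₂⟩ := D
  obtain ⟨e₁, e₂⟩ := E
  obtain ⟨f₁, f₂⟩ := F
  simp only [muW_apply, Jc_mulVec, Jpair]
  refine ⟨⟨fun h => ?_, ?_⟩, ⟨fun h => ?_, ?_⟩, ⟨fun h => ?_, ?_⟩⟩
  · have h13 := h ![1, 0, 0, 0, 0, 0] ![0, 0, 1, 0, 0, 0]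
    simp at h13 ⊢
    constructor <;> linarith [h13.1, h13.2]
  · intro h X Y
    simp at h
    obtain ⟨rfl, rfl⟩ := h
    ext i
    fin_cases i <;> simp <;> ring
  · have h13 := h ![1, 0, 0, 0, 0, 0] ![0, 0, 1, 0, 0, 0]
    have h14 := h ![1, 0, 0, 0, 0, 0] ![0, 0, 0, 1, 0, 0]
    simp at h13 h14 ⊢
    refine ⟨⟨?_, ?_⟩, ?_, ?_⟩ <;> linarith [h13.1, h13.2, h14.1, h14.2]
  · intro h X Y
    simp at h
    obtain ⟨⟨rfl, rfl⟩, rfl, rfl⟩ := h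
    ext i
    fin_cases i <;> simp <;> ring
  · have h12 := h ![1, 0, 0, 0, 0, 0] ![0, 1, 0, 0, 0, 0]
    have h13 := h ![1, 0, 0, 0, 0, 0] ![0, 0, 1, 0, 0, 0]
    have h14 := h ![1, 0, 0, 0, 0, 0] ![0, 0, 0, 1, 0, 0]
    have h31 := h ![0, 0, 1, 0, 0, 0] ![1, 0, 0, 0, 0, 0]
    have h34 := h ![0, 0, 1, 0, 0, 0] ![0, 0, 0, 1, 0, 0]
    simp at h12 h13 h14 h31 h34 ⊢
    refine ⟨⟨?_, ?_⟩, ⟨?_, ?_⟩, ⟨?_, ?_⟩, ⟨?_, ?_⟩, ?_, ?_⟩ <;>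
      linarith [h12.1, h12.2, h13.1, h13.2, h14.1, h14.2, h31.1, h31.2, h34.1, h34.2]
  · intro h X Y
    simp at h
    obtain ⟨⟨rfl, rfl⟩, ⟨rfl, rfl⟩, ⟨rfl, rfl⟩, ⟨rfl, rfl⟩, rfl, rfl⟩ := h
    ext i
    fin_cases i <;> simp <;> ring
end

section
/- Let μ : n₁ × n₁ → n₂ be any skew-symmetric bilinear map, extended to a 2-step nilpotent Lie bracket on ℝ⁶ = n₁ ⊕ n₂ with n₂ central (n₁ = span(X_1,…,X_4), n₂ = span(Z_1,Z_2), all basis vectors orthonormal). Then: (1) for every s ∈ ℝ, the linear map equal to sI on n₁ and 2sI on n₂ is a derivation of μ; (2) the complexified Ricci operator always satisfies Ricc_μ|_{n₂} = qI for some q ∈ ℝ; and (3) if moreover Ricc_μ|_{n₁} = pI for some p ∈ ℝ, then Ricc_μ = (2p−q)I + D where D is the derivation equal to (q−p)I on n₁ and 2(q−p)I on n₂; in particular Ricc_μ ∈ ℝI + Der(μ). -/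
open scoped BigOperators Matrix

/-- The complexified Ricci operator `Ricc_μ = (1/2)(Ric_μ - J Ric_μ J)` on `ℝ⁶`. -/
noncomputable def Ricc6 (μ : Vm 6) : Matrix (Fin 6) (Fin 6) ℝ :=
  (1/2 : ℝ) • (Ric μ - Jc * Ric μ * Jc)

theorem muW_apply_of_lt (A B C D E F : ℝ × ℝ) (X Y : Fin 6 → ℝ) {k : Fin 6} (hk : (k : ℕ) < 4) :
    muW A B C D E F X Y k = 0 := by
  have h4 : k ≠ 4 := by rintro rfl; simp at hk
  have h5 : k ≠ 5 := by rintro rfl; simp at hk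
  simp [muW, zvec, stdb, h4, h5]

theorem muW_stdb_left_of_le (A B C D E F : ℝ × ℝ) (Y : Fin 6 → ℝ) {k : Fin 6}
    (hk : 4 ≤ (k : ℕ)) : muW A B C D E F (stdb 6 k) Y = 0 := by
  have h : ∀ l : Fin 6, (l : ℕ) < 4 → stdb 6 k l = 0 := fun l hl =>
    Pi.single_eq_of_ne (by rintro rfl; omega) _
  simp [muW, h 0 (by decide), h 1 (by decide), h 2 (by decide), h 3 (by decide)]

theorem Ric_symm {m : ℕ} (μ : Vm m) (x y : Fin m) : Ric μ x y = Ric μ y x := by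
  simp [Ric, mul_comm]

theorem Ric_muW_mixed (A B C D E F : ℝ × ℝ) {x y : Fin 6} (hx : (x : ℕ) < 4)
    (hy : 4 ≤ (y : ℕ)) : Ric (muW A B C D E F) x y = 0 := by
  simp [Ric, muW_stdb_left_of_le A B C D E F _ hy, muW_apply_of_lt A B C D E F _ _ hx]

theorem Ricc6_muW_mixed (A B C D E F : ℝ × ℝ) {x y : Fin 6} (hx : (x : ℕ) < 4)
    (hy : 4 ≤ (y : ℕ)) :
    Ricc6 (muW A B C D E F) x y = 0 ∧ Ricc6 (muW A B C D E F) y x = 0 := by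
  have h : ∀ k l : Fin 6, (k : ℕ) < 4 → 4 ≤ (l : ℕ) →
      Ric (muW A B C D E F) k l = 0 ∧ Ric (muW A B C D E F) l k = 0 := fun k l hk hl =>
    ⟨Ric_muW_mixed A B C D E F hk hl, Ric_symm _ l k ▸ Ric_muW_mixed A B C D E F hk hl⟩
  simp only [Ricc6, Matrix.smul_apply, Matrix.sub_apply, Matrix.mul_apply, Fin.sum_univ_six]
  fin_cases x <;> simp at hx <;> fin_cases y <;> simp at hy <;> simp [Jc, h]

theorem Ricc6_center (μ : Vm 6) {x y : Fin 6} (hx : 4 ≤ (x : ℕ)) (hy : 4 ≤ (y : ℕ)) :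
    Ricc6 μ x y = if x = y then (1 / 2) * (Ric μ 4 4 + Ric μ 5 5) else 0 := by
  have h := Ric_symm μ 4 5
  simp only [Ricc6, Matrix.smul_apply, Matrix.sub_apply, Matrix.mul_apply, Fin.sum_univ_six]
  fin_cases x <;> simp at hx <;> fin_cases y <;> simp at hy <;> simp [Jc, h, add_comm]

theorem isDeriv_muW_diagonal (A B C D E F : ℝ × ℝ) (s : ℝ) :
    IsDeriv (muW A B C D E F)
      (Matrix.diagonal (fun i : Fin 6 => if (i : ℕ) < 4 then s else 2 * s)) := by
  intro X Y
  ext k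
  by_cases hk : (k : ℕ) < 4
  · simp [Matrix.mulVec_diagonal, muW_apply_of_lt A B C D E F _ _ hk]
  · simp [Matrix.mulVec_diagonal, muW, hk]
    ring

/-- for any `μ ∈ W`: (1) the map `sI ⊕ 2sI` (i.e. `sI` on `n₁`, `2sI` on `n₂`)
is a derivation; (2) `Ricc_μ|_{n₂} = qI` for some `q`; (3) if moreover `Ricc_μ|_{n₁} = pI`
then `Ricc_μ = (2p-q)I + D` with `D` the derivation `(q-p)I ⊕ 2(q-p)I`; in particular
`Ricc_μ ∈ ℝI + Der(μ)`. -/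
theorem muW_Ricc_structure (A B C D E F : ℝ × ℝ) :
    (∀ s : ℝ, IsDeriv (muW A B C D E F)
        (Matrix.diagonal (fun i : Fin 6 => if (i : ℕ) < 4 then s else 2*s))) ∧
    ∃ q : ℝ,
      (∀ i j : Fin 6, 4 ≤ (i : ℕ) → 4 ≤ (j : ℕ) →
          Ricc6 (muW A B C D E F) i j = if i = j then q else 0) ∧
      ∀ p : ℝ,
        (∀ i j : Fin 6, (i : ℕ) < 4 → (j : ℕ) < 4 →
            Ricc6 (muW A B C D E F) i j = if i = j then p else 0) →
          Ricc6 (muW A B C D E F) =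
              (2*p - q) • (1 : Matrix (Fin 6) (Fin 6) ℝ) +
                Matrix.diagonal (fun i : Fin 6 => if (i : ℕ) < 4 then q - p else 2*(q - p)) ∧
            (∃ (r : ℝ) (Dm : Matrix (Fin 6) (Fin 6) ℝ),
              Ricc6 (muW A B C D E F) = r • (1 : Matrix (Fin 6) (Fin 6) ℝ) + Dm ∧
                IsDeriv (muW A B C D E F) Dm) := by
  refine ⟨isDeriv_muW_diagonal A B C D E F, _, fun i j => Ricc6_center _, fun p hp => ?_⟩
  set q := (1 / 2) * (Ric (muW A B C D E F) 4 4 + Ric (muW A B C D E F) 5 5) with hq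
  have key : Ricc6 (muW A B C D E F) =
      (2*p - q) • (1 : Matrix (Fin 6) (Fin 6) ℝ) +
        Matrix.diagonal (fun i : Fin 6 => if (i : ℕ) < 4 then q - p else 2*(q - p)) := by
    ext i j
    by_cases hi : (i : ℕ) < 4 <;> by_cases hj : (j : ℕ) < 4
    · rw [hp i j hi hj]
      by_cases h : i = j
      · subst h
        simp [hi]
        ring
      · simp [h]
    · have h : i ≠ j := by rintro rfl; exact hj hi
      simp [h, (Ricc6_muW_mixed A B C D E F hi (not_lt.mp hj)).1]
    · have h : i ≠ j := by rintro rfl; exact hi hj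
      simp [h, (Ricc6_muW_mixed A B C D E F hj (not_lt.mp hi)).2]
    · rw [Ricc6_center _ (not_lt.mp hi) (not_lt.mp hj), ← hq]
      by_cases h : i = j
      · subst h
        simp [hi]
        ring
      · simp [h]
  exact ⟨key, _, _, key, isDeriv_muW_diagonal A B C D E F _⟩
end

section
/- For s,t ≥ 0 with s² + t² = 1, let μ_{st} ∈ W be determined by A = (s,t), F = (−s,t), B = C = D = E = 0 (i.e. μ_{st}(X_1,X_2) = sZ_1 + tZ_2, μ_{st}(X_3,X_4) = −sZ_1 + tZ_2, other brackets zero). Then each μ_{st} satisfies Ricc_{μ_{st}} ∈ ℝI + Der(μ_{st}), the restriction of Ric_{μ_{st}} to n₂ equals diag(s², t²), and for distinct parameters (s,t) ≠ (s′,t′) with 0 ≤ s, s′ ≤ 1/√2 there is no orthogonal linear map φ ∈ O(6) with φ(μ_{st}(X,Y)) = μ_{s′t′}(φX, φY) for all X,Y. -/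
open scoped BigOperators Matrix

/-- The Gram matrix, for the trace form, of the bilinear forms `⟨μ(·,·), e_k⟩`. -/
noncomputable def bracketGram {m : ℕ} (μ : Vm m) : Matrix (Fin m) (Fin m) ℝ :=
  Matrix.of fun k l => ∑ i, ∑ j, μ (stdb m i) (stdb m j) k * μ (stdb m i) (stdb m j) l

/-- `μ` is given by its structure constants in the standard basis. -/
def IsBilin {m : ℕ} (μ : Vm m) : Prop :=
  ∀ X Y k, μ X Y k = ∑ i, ∑ j, X i * Y j * μ (stdb m i) (stdb m j) k

lemma mulVec_stdb {m : ℕ} (φ : Matrix (Fin m) (Fin m) ℝ) (i a : Fin m) :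
    φ.mulVec (stdb m i) a = φ a i := by
  simp [stdb]

lemma bracketGram_eq_trace {m : ℕ} (μ : Vm m) (k l : Fin m) :
    bracketGram μ k l =
      ((Matrix.of fun i j => μ (stdb m i) (stdb m j) k) *
        (Matrix.of fun i j => μ (stdb m i) (stdb m j) l)ᵀ).trace := by
  simp [bracketGram, Matrix.trace, Matrix.mul_apply]

/-- The Gram matrix of a bracket is equivariant under orthogonal maps. -/
lemma conj_bracketGram {m : ℕ} {μ ν : Vm m} (hν : IsBilin ν)
    {φ : Matrix (Fin m) (Fin m) ℝ} (hφ : φᵀ * φ = 1)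
    (h : ∀ X Y, φ.mulVec (μ X Y) = ν (φ.mulVec X) (φ.mulVec Y)) :
    φ * bracketGram μ * φᵀ = bracketGram ν := by
  have hφ' : φ * φᵀ = 1 := mul_eq_one_comm.mp hφ
  have key (k : Fin m) : (∑ p, φ k p • Matrix.of fun i j => μ (stdb m i) (stdb m j) p) =
      φᵀ * (Matrix.of fun i j => ν (stdb m i) (stdb m j) k) * φ := by
    ext i j
    have := congrFun (h (stdb m i) (stdb m j)) k
    rw [hν] at this
    simp only [mulVec_stdb] at this
    simp only [Matrix.sum_apply, Matrix.smul_apply, Matrix.of_apply, smul_eq_mul,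
      Matrix.mul_apply, Matrix.transpose_apply]
    rw [Matrix.mulVec, dotProduct] at this
    rw [this, Finset.sum_comm]
    refine Finset.sum_congr rfl fun a _ => ?_
    rw [Finset.sum_mul]
    exact Finset.sum_congr rfl fun b _ => by ring
  ext k l
  have hL : (φ * bracketGram μ * φᵀ) k l =
      ((∑ p, φ k p • Matrix.of fun i j => μ (stdb m i) (stdb m j) p) *
        (∑ p, φ l p • Matrix.of fun i j => μ (stdb m i) (stdb m j) p)ᵀ).trace := by
    simp only [Matrix.transpose_sum, Matrix.transpose_smul, Finset.sum_mul_sum, Matrix.trace_sum,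
      Matrix.smul_mul, Matrix.mul_smul, Matrix.trace_smul, ← bracketGram_eq_trace, smul_eq_mul]
    simp only [Matrix.mul_apply, Matrix.transpose_apply, Finset.sum_mul]
    rw [Finset.sum_comm]
    exact Finset.sum_congr rfl fun a _ => Finset.sum_congr rfl fun b _ => by ring
  rw [hL, key, key, bracketGram_eq_trace, Matrix.transpose_mul, Matrix.transpose_mul,
    Matrix.transpose_transpose]
  generalize (Matrix.of fun i j => ν (stdb m i) (stdb m j) k) = S
  generalize (Matrix.of fun i j => ν (stdb m i) (stdb m j) l) = T
  calc (φᵀ * S * φ * (φᵀ * (Tᵀ * φ))).trace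
      = (φᵀ * (S * (φ * φᵀ) * Tᵀ * φ)).trace := by simp only [Matrix.mul_assoc]
    _ = (S * Tᵀ * (φ * φᵀ)).trace := by
        rw [Matrix.trace_mul_comm]; simp only [Matrix.mul_assoc, hφ', Matrix.one_mul]
    _ = (S * Tᵀ).trace := by rw [hφ', Matrix.mul_one]

lemma trace_sq_bracketGram {m : ℕ} {μ ν : Vm m} (hν : IsBilin ν)
    {φ : Matrix (Fin m) (Fin m) ℝ} (hφ : φᵀ * φ = 1)
    (h : ∀ X Y, φ.mulVec (μ X Y) = ν (φ.mulVec X) (φ.mulVec Y)) :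
    (bracketGram μ * bracketGram μ).trace = (bracketGram ν * bracketGram ν).trace := by
  rw [← conj_bracketGram hν hφ h]
  calc (bracketGram μ * bracketGram μ).trace
      = ((φᵀ * φ) * (bracketGram μ * (φᵀ * φ) * bracketGram μ)).trace := by
        rw [hφ, Matrix.one_mul, Matrix.mul_one]
    _ = (φᵀ * (φ * bracketGram μ * φᵀ * φ * bracketGram μ)).trace := by
        simp only [Matrix.mul_assoc]
    _ = _ := by rw [Matrix.trace_mul_comm]; simp only [Matrix.mul_assoc]

lemma isBilin_muW (A B C D E F : ℝ × ℝ) : IsBilin (muW A B C D E F) := by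
  intro X Y k
  simp [muW, stdb, Fin.sum_univ_six, Pi.single_apply]
  ring

lemma muW_family1_apply (s t : ℝ) (X Y : Fin 6 → ℝ) :
    muW (s, t) 0 0 0 0 (-s, t) X Y =
      ![0, 0, 0, 0, s * (X 0 * Y 1 - X 1 * Y 0) - s * (X 2 * Y 3 - X 3 * Y 2),
        t * (X 0 * Y 1 - X 1 * Y 0) + t * (X 2 * Y 3 - X 3 * Y 2)] := by
  ext k
  fin_cases k <;> simp [muW, zvec, stdb] <;> ring

set_option maxHeartbeats 2000000 in
lemma bracketGram_muW_family1 (s t : ℝ) :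
    bracketGram (muW (s, t) 0 0 0 0 (-s, t)) =
      Matrix.diagonal ![0, 0, 0, 0, 4 * s ^ 2, 4 * t ^ 2] := by
  ext i j
  fin_cases i <;> fin_cases j <;>
    simp [bracketGram, muW_family1_apply, stdb, Fin.sum_univ_six, Matrix.diagonal] <;> ring

set_option maxHeartbeats 2000000 in
lemma Ric_muW_family1 {s t : ℝ} (h : s ^ 2 + t ^ 2 = 1) :
    Ric (muW (s, t) 0 0 0 0 (-s, t)) =
      Matrix.diagonal ![-1/2, -1/2, -1/2, -1/2, s ^ 2, t ^ 2] := by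
  ext i j
  fin_cases i <;> fin_cases j <;>
    simp [Ric, muW_family1_apply, stdb, Fin.sum_univ_six, Matrix.diagonal] <;> linarith

set_option maxHeartbeats 2000000 in
lemma Ricc6_muW_family1 {s t : ℝ} (h : s ^ 2 + t ^ 2 = 1) :
    Ricc6 (muW (s, t) 0 0 0 0 (-s, t)) =
      Matrix.diagonal ![-1/2, -1/2, -1/2, -1/2, 1/2, 1/2] := by
  rw [Ricc6, Ric_muW_family1 h]
  ext i j
  rw [Matrix.smul_apply, Matrix.sub_apply, Matrix.mul_apply]
  simp only [Matrix.mul_diagonal, Fin.sum_univ_six, Matrix.diagonal_apply]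
  fin_cases i <;> fin_cases j <;> simp [Jc] <;> linarith

lemma isDeriv_muW_family1 (s t : ℝ) :
    IsDeriv (muW (s, t) 0 0 0 0 (-s, t)) (Matrix.diagonal ![1, 1, 1, 1, 2, 2]) := by
  intro X Y
  simp only [muW_family1_apply]
  ext k
  fin_cases k <;> simp [Matrix.mulVec_diagonal] <;> ring

lemma sq_le_half_of_le_one_div_sqrt_two {s : ℝ} (hs : 0 ≤ s) (h : s ≤ 1 / Real.sqrt 2) :
    s ^ 2 ≤ 1 / 2 := by
  calc s ^ 2 ≤ (1 / Real.sqrt 2) ^ 2 := pow_le_pow_left₀ hs h 2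
    _ = 1 / 2 := by rw [div_pow, Real.sq_sqrt (by norm_num), one_pow]

/-- for `s,t ≥ 0`, `s² + t² = 1`, the bracket `μ_{st} ∈ W` with
`A = (s,t)`, `F = (-s,t)`, `B = C = D = E = 0` satisfies `Ricc_{μ_{st}} ∈ ℝI + Der(μ_{st})`,
`Ric_{μ_{st}}|_{n₂} = diag(s²,t²)`, and for distinct parameters in `0 ≤ s ≤ 1/√2` the
metrics are pairwise non-isometric. -/
theorem muW_family1 (s t s' t' : ℝ)
    (hs : 0 ≤ s) (ht : 0 ≤ t) (h1 : s^2 + t^2 = 1) (hs2 : s ≤ 1 / Real.sqrt 2)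
    (hs' : 0 ≤ s') (ht' : 0 ≤ t') (h1' : s'^2 + t'^2 = 1) (hs2' : s' ≤ 1 / Real.sqrt 2) :
    (∃ (c : ℝ) (Dm : Matrix (Fin 6) (Fin 6) ℝ),
        Ricc6 (muW (s, t) 0 0 0 0 (-s, t)) = c • (1 : Matrix (Fin 6) (Fin 6) ℝ) + Dm ∧
        IsDeriv (muW (s, t) 0 0 0 0 (-s, t)) Dm) ∧
    (∀ i j : Fin 6, 4 ≤ (i : ℕ) → 4 ≤ (j : ℕ) →
        Ric (muW (s, t) 0 0 0 0 (-s, t)) i j =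
          if i = j then (if (i : ℕ) = 4 then s^2 else t^2) else 0) ∧
    ((s, t) ≠ (s', t') →
      ¬ ∃ φ : Matrix (Fin 6) (Fin 6) ℝ, φᵀ * φ = 1 ∧
          ∀ X Y : Fin 6 → ℝ,
            φ.mulVec (muW (s, t) 0 0 0 0 (-s, t) X Y) =
              muW (s', t') 0 0 0 0 (-s', t') (φ.mulVec X) (φ.mulVec Y)) := by
  refine ⟨⟨-3/2, Matrix.diagonal ![1, 1, 1, 1, 2, 2], ?_, isDeriv_muW_family1 s t⟩, ?_, ?_⟩
  · rw [Ricc6_muW_family1 h1]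
    ext i j
    fin_cases i <;> fin_cases j <;> norm_num [Matrix.diagonal]
  · intro i j hi hj
    rw [Ric_muW_family1 h1]
    fin_cases i <;> fin_cases j <;> simp_all [Matrix.diagonal]
  · rintro hne ⟨φ, hφ, h⟩
    have htr := trace_sq_bracketGram (isBilin_muW _ _ _ _ _ _) hφ h
    simp only [bracketGram_muW_family1, Matrix.diagonal_mul_diagonal, Matrix.trace_diagonal] at htr
    simp [Fin.sum_univ_six] at htr
    have hb := sq_le_half_of_le_one_div_sqrt_two hs hs2
    have hb' := sq_le_half_of_le_one_div_sqrt_two hs' hs2'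
    have ht2 : t ^ 2 = 1 - s ^ 2 := by linarith
    have ht2' : t' ^ 2 = 1 - s' ^ 2 := by linarith
    rw [ht2, ht2'] at htr
    have hprod : (s ^ 2 - s' ^ 2) * (s ^ 2 + s' ^ 2 - 1) = 0 := by linarith
    have hss : s ^ 2 = s' ^ 2 := by
      rcases mul_eq_zero.mp hprod with h0 | h0 <;> linarith
    have e1 : s = s' := (pow_left_inj₀ hs hs' two_ne_zero).mp hss
    have e2 : t = t' := (pow_left_inj₀ ht ht' two_ne_zero).mp (by linarith)
    exact hne (by rw [e1, e2])
end

section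
/- Let μ ∈ W₈ be determined by coefficient vectors A,B,C,D,E,F ∈ ℝ⁴, and set T = C + D. Then the three complex structures J₁, J₂, J₃ are all integrable on (ℝ⁸, μ) — i.e. μ(J_iX, J_iY) = μ(X,Y) + J_iμ(J_iX,Y) + J_iμ(X,J_iY) for all X,Y and i = 1,2,3 — if and only if E = B + J₁T and F = −A + J₂T. Moreover, the resulting hypercomplex structure is abelian (μ(J_iX, J_iY) = μ(X,Y) for all X,Y and i = 1,2,3) if and only if in addition T = 0, i.e. D = −C, E = B and F = −A. -/
open scoped BigOperators Matrix

/-- `J₁` on `ℝ⁸ = n₁ ⊕ n₂`, acting on each factor by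
`[[0,-1,0,0],[1,0,0,0],[0,0,0,-1],[0,0,1,0]]`. -/
noncomputable def J1m : Matrix (Fin 8) (Fin 8) ℝ :=
  !![0,-1, 0, 0, 0, 0, 0, 0;
     1, 0, 0, 0, 0, 0, 0, 0;
     0, 0, 0,-1, 0, 0, 0, 0;
     0, 0, 1, 0, 0, 0, 0, 0;
     0, 0, 0, 0, 0,-1, 0, 0;
     0, 0, 0, 0, 1, 0, 0, 0;
     0, 0, 0, 0, 0, 0, 0,-1;
     0, 0, 0, 0, 0, 0, 1, 0]

/-- `J₂` on `ℝ⁸ = n₁ ⊕ n₂`, acting on each factor by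
`[[0,0,-1,0],[0,0,0,1],[1,0,0,0],[0,-1,0,0]]`. -/
noncomputable def J2m : Matrix (Fin 8) (Fin 8) ℝ :=
  !![0, 0,-1, 0, 0, 0, 0, 0;
     0, 0, 0, 1, 0, 0, 0, 0;
     1, 0, 0, 0, 0, 0, 0, 0;
     0,-1, 0, 0, 0, 0, 0, 0;
     0, 0, 0, 0, 0, 0,-1, 0;
     0, 0, 0, 0, 0, 0, 0, 1;
     0, 0, 0, 0, 1, 0, 0, 0;
     0, 0, 0, 0, 0,-1, 0, 0]

/-- `J₃ = J₁J₂` on `ℝ⁸ = n₁ ⊕ n₂`, acting on each factor by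
`[[0,0,0,-1],[0,0,-1,0],[0,1,0,0],[1,0,0,0]]`. -/
noncomputable def J3m : Matrix (Fin 8) (Fin 8) ℝ :=
  !![0, 0, 0,-1, 0, 0, 0, 0;
     0, 0,-1, 0, 0, 0, 0, 0;
     0, 1, 0, 0, 0, 0, 0, 0;
     1, 0, 0, 0, 0, 0, 0, 0;
     0, 0, 0, 0, 0, 0, 0,-1;
     0, 0, 0, 0, 0, 0,-1, 0;
     0, 0, 0, 0, 0, 1, 0, 0;
     0, 0, 0, 0, 1, 0, 0, 0]

/-- `J₁` acting on coefficient vectors in `ℝ⁴`. -/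
noncomputable def J1b : Matrix (Fin 4) (Fin 4) ℝ :=
  !![0,-1, 0, 0; 1, 0, 0, 0; 0, 0, 0,-1; 0, 0, 1, 0]

/-- `J₂` acting on coefficient vectors in `ℝ⁴`. -/
noncomputable def J2b : Matrix (Fin 4) (Fin 4) ℝ :=
  !![0, 0,-1, 0; 0, 0, 0, 1; 1, 0, 0, 0; 0,-1, 0, 0]

/-- The vector `a₁Z_1 + a₂Z_2 + a₃Z_3 + a₄Z_4 ∈ n₂ ⊆ ℝ⁸`. -/
noncomputable def zvec8 (a : Fin 4 → ℝ) : Fin 8 → ℝ :=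
  a 0 • stdb 8 4 + a 1 • stdb 8 5 + a 2 • stdb 8 6 + a 3 • stdb 8 7

/-- The element of `W₈ = Λ²n₁* ⊗ n₂` (extended to a 2-step nilpotent bracket on
`ℝ⁸ = n₁ ⊕ n₂` with `n₂` central) with coefficient vectors `A,B,C,D,E,F ∈ ℝ⁴`:
`μ(X_1,X_2) = Σ aₖZₖ`, `μ(X_1,X_3) = Σ bₖZₖ`, `μ(X_1,X_4) = Σ cₖZₖ`,
`μ(X_2,X_3) = Σ dₖZₖ`, `μ(X_2,X_4) = Σ eₖZₖ`, `μ(X_3,X_4) = Σ fₖZₖ`. -/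
noncomputable def muW8 (A B C D E F : Fin 4 → ℝ) : Vm 8 :=
  fun X Y =>
    (X 0 * Y 1 - X 1 * Y 0) • zvec8 A +
    (X 0 * Y 2 - X 2 * Y 0) • zvec8 B +
    (X 0 * Y 3 - X 3 * Y 0) • zvec8 C +
    (X 1 * Y 2 - X 2 * Y 1) • zvec8 D +
    (X 1 * Y 3 - X 3 * Y 1) • zvec8 E +
    (X 2 * Y 3 - X 3 * Y 2) • zvec8 F

/-- The almost-complex structure given by the matrix `Jm` is integrable on `(ℝ⁸, μ)`. -/
def Integr8 (Jm : Matrix (Fin 8) (Fin 8) ℝ) (μ : Vm 8) : Prop :=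
  ∀ X Y : Fin 8 → ℝ,
    μ (Jm.mulVec X) (Jm.mulVec Y) =
      μ X Y + Jm.mulVec (μ (Jm.mulVec X) Y) + Jm.mulVec (μ X (Jm.mulVec Y))

theorem zvec8_eq (a : Fin 4 → ℝ) : zvec8 a = ![0, 0, 0, 0, a 0, a 1, a 2, a 3] := by
  ext i; fin_cases i <;> simp [zvec8, stdb]

theorem J1m_mulVec (X : Fin 8 → ℝ) :
    J1m.mulVec X = ![-X 1, X 0, -X 3, X 2, -X 5, X 4, -X 7, X 6] := by
  ext i; fin_cases i <;> simp [J1m, Matrix.mulVec, dotProduct, Fin.sum_univ_succ]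

theorem J2m_mulVec (X : Fin 8 → ℝ) :
    J2m.mulVec X = ![-X 2, X 3, X 0, -X 1, -X 6, X 7, X 4, -X 5] := by
  ext i; fin_cases i <;> simp [J2m, Matrix.mulVec, dotProduct, Fin.sum_univ_succ]

theorem J3m_mulVec (X : Fin 8 → ℝ) :
    J3m.mulVec X = ![-X 3, -X 2, X 1, X 0, -X 7, -X 6, X 5, X 4] := by
  ext i; fin_cases i <;> simp [J3m, Matrix.mulVec, dotProduct, Fin.sum_univ_succ]

theorem J1b_mulVec (a : Fin 4 → ℝ) : J1b.mulVec a = ![-a 1, a 0, -a 3, a 2] := by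
  ext i; fin_cases i <;> simp [J1b, Matrix.mulVec, dotProduct, Fin.sum_univ_succ]

theorem J2b_mulVec (a : Fin 4 → ℝ) : J2b.mulVec a = ![-a 2, a 3, a 0, -a 1] := by
  ext i; fin_cases i <;> simp [J2b, Matrix.mulVec, dotProduct, Fin.sum_univ_succ]

set_option maxHeartbeats 1000000 in
theorem integr8_muW8_iff (A B C D E F : Fin 4 → ℝ) :
    (Integr8 J1m (muW8 A B C D E F) ∧ Integr8 J2m (muW8 A B C D E F) ∧
        Integr8 J3m (muW8 A B C D E F)) ↔
      (E = B + J1b.mulVec (C + D) ∧ F = -A + J2b.mulVec (C + D)) := by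
  constructor
  · rintro ⟨h1, h2, -⟩
    have h1 := h1 ![1, 0, 0, 0, 0, 0, 0, 0] ![0, 0, 1, 0, 0, 0, 0, 0]
    have h2 := h2 ![1, 0, 0, 0, 0, 0, 0, 0] ![0, 1, 0, 0, 0, 0, 0, 0]
    simp [J1m_mulVec, J2m_mulVec, muW8, zvec8_eq] at h1 h2
    constructor <;> ext i <;> fin_cases i <;> simp [J1b_mulVec, J2b_mulVec] <;> linarith
  · rintro ⟨rfl, rfl⟩
    refine ⟨fun X Y => ?_, fun X Y => ?_, fun X Y => ?_⟩ <;> ext i <;> fin_cases i <;>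
      simp [J1m_mulVec, J2m_mulVec, J3m_mulVec, J1b_mulVec, J2b_mulVec, muW8, zvec8_eq,
        Matrix.vecHead, Matrix.vecTail] <;> ring

theorem abelian_muW8_iff (A B C D E F : Fin 4 → ℝ) :
    (∀ X Y : Fin 8 → ℝ,
        muW8 A B C D E F (J1m.mulVec X) (J1m.mulVec Y) = muW8 A B C D E F X Y ∧
        muW8 A B C D E F (J2m.mulVec X) (J2m.mulVec Y) = muW8 A B C D E F X Y ∧
        muW8 A B C D E F (J3m.mulVec X) (J3m.mulVec Y) = muW8 A B C D E F X Y) ↔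
      (D = -C ∧ E = B ∧ F = -A) := by
  constructor
  · intro h
    have hB := (h ![1, 0, 0, 0, 0, 0, 0, 0] ![0, 0, 1, 0, 0, 0, 0, 0]).1
    have hC := (h ![1, 0, 0, 0, 0, 0, 0, 0] ![0, 0, 0, 1, 0, 0, 0, 0]).1
    have hA := (h ![1, 0, 0, 0, 0, 0, 0, 0] ![0, 1, 0, 0, 0, 0, 0, 0]).2.1
    simp [J1m_mulVec, J2m_mulVec, muW8, zvec8_eq] at hA hB hC
    refine ⟨?_, ?_, ?_⟩ <;> ext i <;> fin_cases i <;> simp <;> linarith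
  · rintro ⟨rfl, rfl, rfl⟩ X Y
    refine ⟨?_, ?_, ?_⟩ <;> ext i <;> fin_cases i <;>
      simp [J1m_mulVec, J2m_mulVec, J3m_mulVec, muW8, zvec8_eq] <;> ring

/-- for `μ ∈ W₈` with coefficient vectors `A,…,F` and `T = C + D`:
`J₁, J₂, J₃` are all integrable iff `E = B + J₁T` and `F = -A + J₂T`; moreover the
hypercomplex structure is abelian iff `D = -C`, `E = B` and `F = -A` (i.e. in
addition `T = 0`). -/
theorem muW8_hypercomplex_conditions (A B C D E F : Fin 4 → ℝ) :
    ((Integr8 J1m (muW8 A B C D E F) ∧ Integr8 J2m (muW8 A B C D E F) ∧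
        Integr8 J3m (muW8 A B C D E F)) ↔
      (E = B + J1b.mulVec (C + D) ∧ F = -A + J2b.mulVec (C + D))) ∧
    ((∀ X Y : Fin 8 → ℝ,
        muW8 A B C D E F (J1m.mulVec X) (J1m.mulVec Y) = muW8 A B C D E F X Y ∧
        muW8 A B C D E F (J2m.mulVec X) (J2m.mulVec Y) = muW8 A B C D E F X Y ∧
        muW8 A B C D E F (J3m.mulVec X) (J3m.mulVec Y) = muW8 A B C D E F X Y) ↔
      (D = -C ∧ E = B ∧ F = -A)) := by
  exact ⟨integr8_muW8_iff A B C D E F, abelian_muW8_iff A B C D E F⟩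
end
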